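/- arXiv:1605.09037 — 17 statements merged into one kernel-verified Lean document; each statement's English description precedes it below -/
import Mathlib

section
/- Existence of unstable Riccati solutions: Let t₀ < t₁ be real numbers and let k : (t₀,t₁] → ℝ be a C¹ function with k(t) > 0 for all t ∈ (t₀,t₁] and k(t) → +∞ as t → t₀⁺. Then there exists a differentiable function ζ : (t₀,t₁] → ℝ satisfying ζ'(t) = 1 − k(t)²ζ(t)² for all t ∈ (t₀,t₁], with ζ(t) > 0 for all t ∈ (t₀,t₁] and ζ(t) → 0 as t → t₀⁺. -/
open Set Filter Topology

lemma fence_nonneg {w w' : ℝ → ℝ} {a b : ℝ}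
    (hw : ∀ t ∈ Icc a b, HasDerivWithinAt w (w' t) (Icc a b) t)
    (h0 : 0 ≤ w a) (h : ∀ t ∈ Icc a b, w t < 0 → 0 ≤ w' t) :
    ∀ t ∈ Icc a b, 0 ≤ w t := by
  intro t ht
  have key : ∀ ε > 0, -w t ≤ ε * (1 + (t - a)) := by
    intro ε hε
    refine image_le_of_deriv_right_lt_deriv_boundary' (f := fun t => - w t) (f' := fun t => - w' t)
      (a := a) (b := b) (B := fun t => ε * (1 + (t - a))) (B' := fun _ => ε) ?_ ?_ ?_ ?_ ?_ ?_ ht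
    · exact fun x hx => (hw x hx).continuousWithinAt.neg
    · intro x hx
      have h1 := (hw x ⟨hx.1, hx.2.le⟩).neg
      refine h1.mono_of_mem_nhdsWithin ?_
      exact Icc_mem_nhdsGE_of_mem hx
    · simp; linarith
    · fun_prop
    · intro x hx
      have : HasDerivAt (fun t => ε * (1 + (t - a))) (ε * 1) x :=
        (((hasDerivAt_id x).sub_const a).const_add 1).const_mul ε
      simpa using this.hasDerivWithinAt
    · intro x hx hxe
      have hx1 := hx.1
      have : 0 < ε * (1 + (x - a)) := mul_pos hε (by linarith)
      have := h x ⟨hx.1, hx.2.le⟩ (by linarith)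
      linarith
  by_contra hc
  push Not at hc
  have ha : 0 < 1 + (t - a) := by have := ht.1; linarith
  have := key (-w t / (2 * (1 + (t-a)))) (div_pos (by linarith) (by linarith))
  have e : -w t / (2 * (1 + (t-a))) * (1 + (t-a)) = -w t / 2 := by field_simp
  linarith

lemma exists_sol {k : ℝ → ℝ} {s T : ℝ} (hs : s ≤ T) (hk : ContinuousOn k (Icc s T)) :
    ∃ z : ℝ → ℝ, z s = 0 ∧
      (∀ t ∈ Icc s T, HasDerivWithinAt z (1 - (k t)^2 * (z t)^2) (Icc s T) t) ∧
      ∀ t ∈ Icc s T, 0 ≤ z t ∧ z t ≤ t - s := by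
  obtain ⟨C, hC⟩ := isCompact_Icc.exists_bound_of_continuousOn hk
  have hC0 : 0 ≤ C := (norm_nonneg _).trans (hC s ⟨le_rfl, hs⟩)
  have hk2 : ∀ t ∈ Icc s T, (k t)^2 ≤ C^2 := fun t ht => by
    have := hC t ht
    rw [Real.norm_eq_abs] at this
    exact sq_le_sq' (by linarith [neg_abs_le (k t)]) ((le_abs_self _).trans this)
  set M := T - s with hM
  have hM0 : 0 ≤ M := by linarith
  let c : ℝ → ℝ := fun x => max 0 (min M x)
  have hc0 : ∀ x, 0 ≤ c x := fun x => le_max_left _ _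
  have hcM : ∀ x, c x ≤ M := fun x => max_le hM0 (min_le_left _ _)
  have hcl : ∀ x y, |c x - c y| ≤ |x - y| := fun x y => by
    have := ((LipschitzWith.id (α := ℝ)).const_min M).const_max 0 |>.dist_le_mul x y
    simpa [Real.dist_eq] using this
  let L : NNReal := ⟨1 + C^2 * M^2, by positivity⟩
  let K : NNReal := ⟨C^2 * (2 * M), by positivity⟩
  let A : NNReal := ⟨(1 + C^2 * M^2) * M, by positivity⟩
  have hP : IsPicardLindelof (fun t x => 1 - (k t)^2 * (c x)^2) (tmin := s) (tmax := T)
      ⟨s, le_rfl, hs⟩ 0 A 0 L K := by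
    constructor
    · intro t ht
      refine LipschitzOnWith.of_dist_le_mul fun x _ y _ => ?_
      rw [Real.dist_eq, Real.dist_eq]
      have e : (1 - (k t)^2 * (c x)^2) - (1 - (k t)^2 * (c y)^2)
        = -((k t)^2 * ((c x + c y) * (c x - c y))) := by ring
      rw [e, abs_neg, abs_mul, abs_mul, abs_of_nonneg (sq_nonneg (k t)),
        abs_of_nonneg (add_nonneg (hc0 x) (hc0 y))]
      change _ ≤ C^2 * (2 * M) * _
      rw [mul_assoc]
      have := hk2 t ht
      have := hcl x y
      have := hcM x
      have := hcM y
      gcongr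
      linarith
    · intro x _
      fun_prop
    · intro t ht x _
      change _ ≤ 1 + C^2 * M^2
      refine (norm_sub_le _ _).trans ?_
      rw [norm_one, Real.norm_of_nonneg (by positivity)]
      have := hk2 t ht
      have := hcM x
      have := hc0 x
      gcongr
    · change (1 + C^2 * M^2) * max (T - s) (s - s) ≤ (1 + C^2 * M^2) * M - 0
      rw [sub_self, max_eq_left hM0, sub_zero]
  obtain ⟨z, hz0, hz⟩ := hP.exists_eq_forall_mem_Icc_hasDerivWithinAt₀
  replace hz0 : z s = 0 := hz0
  have hpos : ∀ t ∈ Icc s T, 0 ≤ z t := by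
    refine fence_nonneg hz hz0.ge fun t ht hneg => ?_
    have : c (z t) = 0 := max_eq_left ((min_le_right _ _).trans hneg.le)
    simp [this]
  have hle : ∀ t ∈ Icc s T, 0 ≤ (t - s) - z t := by
    refine fence_nonneg (w' := fun t => 1 - (1 - (k t)^2 * (c (z t))^2)) (fun t ht => ?_) ?_ ?_
    · exact ((hasDerivWithinAt_id t _).sub_const s).sub (hz t ht)
    · simp [hz0]
    · intro t ht _
      have : 0 ≤ (k t)^2 * (c (z t))^2 := by positivity
      linarith
  refine ⟨z, hz0, fun t ht => ?_, fun t ht => ⟨hpos t ht, by linarith [hle t ht]⟩⟩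
  have : c (z t) = z t := by
    have h1 := hpos t ht
    have h2 : z t ≤ M := by linarith [hle t ht, ht.2]
    simp [c, h1, h2]
  have h := hz t ht
  rwa [this] at h

lemma sol_mono {k x y : ℝ → ℝ} {s T : ℝ}
    (hx : ∀ t ∈ Icc s T, HasDerivWithinAt x (1 - (k t)^2 * (x t)^2) (Icc s T) t)
    (hy : ∀ t ∈ Icc s T, HasDerivWithinAt y (1 - (k t)^2 * (y t)^2) (Icc s T) t)
    (hx0 : ∀ t ∈ Icc s T, 0 ≤ x t) (hy0 : ∀ t ∈ Icc s T, 0 ≤ y t) (h : x s ≤ y s) :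
    ∀ t ∈ Icc s T, x t ≤ y t := by
  have := fence_nonneg (fun t ht => (hy t ht).sub (hx t ht)) (by simpa using h) ?_
  · intro t ht
    have := this t ht
    simp at this
    exact this
  · intro t ht hlt
    have hlt : y t - x t < 0 := hlt
    have h1 := hx0 t ht
    have h2 := hy0 t ht
    have : (y t)^2 ≤ (x t)^2 := by nlinarith
    nlinarith [mul_le_mul_of_nonneg_left this (sq_nonneg (k t))]

lemma sol_limit {k ζ : ℝ → ℝ} {a T M : ℝ} {y : ℕ → ℝ → ℝ} (hk : ContinuousOn k (Icc a T))
    (hy : ∀ᶠ n in atTop, (∀ t ∈ Icc a T,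
      HasDerivWithinAt (y n) (1 - (k t)^2 * (y n t)^2) (Icc a T) t) ∧
      ∀ t ∈ Icc a T, 0 ≤ y n t ∧ y n t ≤ M)
    (hlim : ∀ t ∈ Icc a T, Tendsto (fun n => y n t) atTop (𝓝 (ζ t))) :
    ∀ t ∈ Icc a T, HasDerivWithinAt ζ (1 - (k t)^2 * (ζ t)^2) (Icc a T) t := by
  obtain ⟨C, hC⟩ := isCompact_Icc.exists_bound_of_continuousOn hk
  have hk2 : ∀ t ∈ Icc a T, (k t)^2 ≤ C^2 := fun t ht => by
    have := hC t ht
    rw [Real.norm_eq_abs] at this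
    exact sq_le_sq' (by linarith [neg_abs_le (k t)]) ((le_abs_self _).trans this)
  set D := 1 + C^2 * M^2 with hD
  have hbd : ∀ᶠ n in atTop, ∀ t ∈ Icc a T, ‖1 - (k t)^2 * (y n t)^2‖ ≤ D := by
    filter_upwards [hy] with n hn t ht
    refine (norm_sub_le _ _).trans ?_
    rw [norm_one, Real.norm_of_nonneg (by positivity)]
    have := hk2 t ht
    have := hn.2 t ht
    rw [hD]
    gcongr
    · exact this.1
    · exact this.2
  have hζc : ContinuousOn ζ (Icc a T) := by
    have hl : ∀ u ∈ Icc a T, ∀ v ∈ Icc a T, ‖ζ u - ζ v‖ ≤ D * ‖u - v‖ := by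
      intro u hu v hv
      refine le_of_tendsto ((hlim u hu).sub (hlim v hv)).norm ?_
      filter_upwards [hy, hbd] with n hn hb
      exact Convex.norm_image_sub_le_of_norm_hasDerivWithin_le hn.1 hb (convex_Icc a T) hv hu
    have : LipschitzOnWith D.toNNReal ζ (Icc a T) := by
      refine LipschitzOnWith.of_dist_le_mul fun u hu v hv => ?_
      rw [dist_eq_norm, dist_eq_norm, Real.coe_toNNReal _ (by positivity)]
      exact hl u hu v hv
    exact this.continuousOn
  have hfc : ContinuousOn (fun t => 1 - (k t)^2 * (ζ t)^2) (Icc a T) := by fun_prop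
  have hint : ∀ t ∈ Icc a T, ζ t = ζ a + ∫ u in a..t, (1 - (k u)^2 * (ζ u)^2) := by
    intro t ht
    have hsub : Icc a t ⊆ Icc a T := Icc_subset_Icc_right ht.2
    have hsub' : uIoc a t ⊆ Icc a T := by
      rw [uIoc_of_le ht.1]; exact Ioc_subset_Icc_self.trans hsub
    have h1 : Tendsto (fun n => ∫ u in a..t, (1 - (k u)^2 * (y n u)^2)) atTop
        (𝓝 (∫ u in a..t, (1 - (k u)^2 * (ζ u)^2))) := by
      refine intervalIntegral.tendsto_integral_filter_of_dominated_convergence (fun _ => D)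
        ?_ ?_ ?_ ?_
      · filter_upwards [hy] with n hn
        have hc : ContinuousOn (y n) (Icc a T) := fun u hu => (hn.1 u hu).continuousWithinAt
        have : ContinuousOn (fun u => 1 - (k u)^2 * (y n u)^2) (Icc a T) := by fun_prop
        exact (this.mono hsub').aestronglyMeasurable measurableSet_uIoc
      · filter_upwards [hbd] with n hn
        exact .of_forall fun u hu => hn u (hsub' hu)
      · simp
      · refine .of_forall fun u hu => ?_
        exact (((hlim u (hsub' hu)).pow 2).const_mul _).const_sub 1
    have h2 : Tendsto (fun n => ∫ u in a..t, (1 - (k u)^2 * (y n u)^2)) atTop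
        (𝓝 (ζ t - ζ a)) := by
      refine ((hlim t ht).sub (hlim a ⟨le_rfl, ht.1.trans ht.2⟩)).congr' ?_
      filter_upwards [hy] with n hn
      have hc : ContinuousOn (y n) (Icc a T) := fun u hu => (hn.1 u hu).continuousWithinAt
      have hc2 : ContinuousOn (fun u => 1 - (k u)^2 * (y n u)^2) (Icc a T) := by fun_prop
      symm
      refine intervalIntegral.integral_eq_sub_of_hasDerivAt_of_le ht.1 (hc.mono hsub) ?_ ?_
      · intro u hu
        exact (hn.1 u (hsub ⟨hu.1.le, hu.2.le⟩)).hasDerivAt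
          (Icc_mem_nhds hu.1 (hu.2.trans_le ht.2))
      · refine ContinuousOn.intervalIntegrable ?_
        rw [uIcc_of_le ht.1]; exact hc2.mono hsub
    linarith [tendsto_nhds_unique h1 h2]
  intro t ht
  haveI : Fact (t ∈ Icc a T) := ⟨ht⟩
  have hd : HasDerivWithinAt (fun t => ∫ u in a..t, (1 - (k u)^2 * (ζ u)^2))
      (1 - (k t)^2 * (ζ t)^2) (Icc a T) t := by
    refine intervalIntegral.integral_hasDerivWithinAt_right
      (f := fun u => 1 - (k u)^2 * (ζ u)^2) ?_ (t := Icc a T) ?_ (hfc t ht)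
    · refine ContinuousOn.intervalIntegrable ?_
      rw [uIcc_of_le ht.1]; exact hfc.mono (Icc_subset_Icc_right ht.2)
    · exact hfc.stronglyMeasurableAtFilter_nhdsWithin measurableSet_Icc t
  exact (hd.const_add (ζ a)).congr hint (hint t ht)


/-- **Existence of unstable Riccati solutions.**
Let `t₀ < t₁` and let `k : (t₀,t₁] → ℝ` be `C¹` with `k > 0` on `(t₀,t₁]` and
`k(t) → +∞` as `t → t₀⁺`.  Then there is a differentiable `ζ : (t₀,t₁] → ℝ`
with `ζ' = 1 - k²ζ²` on `(t₀,t₁]`, `ζ > 0` on `(t₀,t₁]`, and `ζ(t) → 0` as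
`t → t₀⁺`. -/
theorem unstable_riccati_exists
    (t₀ t₁ : ℝ) (ht : t₀ < t₁)
    (k : ℝ → ℝ)
    (hk : ContDiffOn ℝ 1 k (Set.Ioc t₀ t₁))
    (hkpos : ∀ t ∈ Set.Ioc t₀ t₁, 0 < k t)
    (hktop : Filter.Tendsto k (nhdsWithin t₀ (Set.Ioi t₀)) Filter.atTop) :
    ∃ ζ : ℝ → ℝ,
      (∀ t ∈ Set.Ioc t₀ t₁,
        HasDerivWithinAt ζ (1 - (k t) ^ 2 * (ζ t) ^ 2) (Set.Ioc t₀ t₁) t) ∧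
      (∀ t ∈ Set.Ioc t₀ t₁, 0 < ζ t) ∧
      Filter.Tendsto ζ (nhdsWithin t₀ (Set.Ioi t₀)) (nhds 0) := by

  classical
  have hkc : ContinuousOn k (Ioc t₀ t₁) := hk.continuousOn
  have hkI : ∀ s, t₀ < s → ContinuousOn k (Icc s t₁) := fun s hs =>
    hkc.mono fun u hu => ⟨hs.trans_le hu.1, hu.2⟩
  let s : ℕ → ℝ := fun n => t₀ + (t₁ - t₀) / (n + 1)
  have hM : 0 < t₁ - t₀ := by linarith
  have hs0 : ∀ n, t₀ < s n := fun n => by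
    have : 0 < (t₁ - t₀) / ((n:ℝ) + 1) := by positivity
    simp only [s]; linarith
  have hs1 : ∀ n, s n ≤ t₁ := fun n => by
    have : (t₁ - t₀) / ((n:ℝ) + 1) ≤ t₁ - t₀ := div_le_self hM.le (by simp)
    simp only [s]; linarith
  have hsanti : Antitone s := fun m n hmn => by
    simp only [s]; gcongr
  have hslim : Tendsto s atTop (𝓝 t₀) := by
    have h1 : Tendsto (fun n : ℕ => (t₁ - t₀) * (1 / ((n:ℝ) + 1))) atTop (𝓝 ((t₁ - t₀) * 0)) :=
      tendsto_one_div_add_atTop_nhds_zero_nat.const_mul _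
    have h2 := h1.const_add t₀
    simp only [mul_zero, add_zero] at h2
    refine h2.congr fun n => ?_
    simp only [s]; ring
  choose z hz0 hz hzb using fun n => exists_sol (hs1 n) (hkI (s n) (hs0 n))
  let y : ℕ → ℝ → ℝ := fun n t => if t < s n then 0 else z n t
  have hyz : ∀ n t, s n ≤ t → y n t = z n t := fun n t h => if_neg (not_lt.2 h)
  have hy0 : ∀ n, ∀ t ≤ t₁, 0 ≤ y n t := fun n t ht' => by
    by_cases h : t < s n
    · simp [y, h]
    · push Not at h
      rw [hyz n t h]; exact (hzb n t ⟨h, ht'⟩).1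
  have hyM : ∀ n, ∀ t ∈ Ioc t₀ t₁, y n t ≤ t - t₀ := fun n t ht' => by
    by_cases h : t < s n
    · simp [y, h, ht'.1.le]
    · push Not at h
      rw [hyz n t h]; linarith [(hzb n t ⟨h, ht'.2⟩).2, hs0 n]
  have hmono : ∀ t ∈ Ioc t₀ t₁, Monotone (fun n => y n t) := by
    intro t ht' m n hmn
    by_cases h : t < s m
    · have : y m t = 0 := if_pos h
      simp only [this]
      exact hy0 n t ht'.2
    · push Not at h
      have hsm := hsanti hmn
      have hsub : Icc (s m) t₁ ⊆ Icc (s n) t₁ := Icc_subset_Icc_left hsm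
      simp only [hyz m t h, hyz n t (hsm.trans h)]
      refine sol_mono (hz m) (fun u hu => (hz n u (hsub hu)).mono hsub)
        (fun u hu => (hzb m u hu).1) (fun u hu => (hzb n u (hsub hu)).1) ?_ t ⟨h, ht'.2⟩
      rw [hz0]
      exact (hzb n (s m) ⟨hsm, hs1 m⟩).1
  let ζ : ℝ → ℝ := fun t => ⨆ n, y n t
  have hlim : ∀ t ∈ Ioc t₀ t₁, Tendsto (fun n => y n t) atTop (𝓝 (ζ t)) := fun t ht' =>
    tendsto_atTop_ciSup (hmono t ht') ⟨t - t₀, by rintro _ ⟨n, rfl⟩; exact hyM n t ht'⟩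
  have hζ0 : ∀ t ∈ Ioc t₀ t₁, 0 ≤ ζ t := fun t ht' =>
    ge_of_tendsto' (hlim t ht') fun n => hy0 n t ht'.2
  have hζM : ∀ t ∈ Ioc t₀ t₁, ζ t ≤ t - t₀ := fun t ht' =>
    le_of_tendsto' (hlim t ht') fun n => hyM n t ht'
  have hderiv : ∀ t ∈ Ioc t₀ t₁,
      HasDerivWithinAt ζ (1 - (k t) ^ 2 * (ζ t) ^ 2) (Ioc t₀ t₁) t := by
    intro t ht'
    obtain ⟨a, ha0, hat⟩ := exists_between ht'.1
    have hsub : Icc a t₁ ⊆ Ioc t₀ t₁ := fun u hu => ⟨ha0.trans_le hu.1, hu.2⟩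
    have := sol_limit (ζ := ζ) (y := y) (M := t₁ - t₀) (hkI a ha0) ?_
      (fun u hu => hlim u (hsub hu)) t ⟨hat.le, ht'.2⟩
    · refine this.mono_of_mem_nhdsWithin ?_
      have h1 : Ioi a ∈ 𝓝[Ioc t₀ t₁] t := mem_nhdsWithin_of_mem_nhds (Ioi_mem_nhds hat)
      filter_upwards [h1, self_mem_nhdsWithin] with u hu hu'
      exact ⟨le_of_lt hu, hu'.2⟩
    · filter_upwards [hslim.eventually (gt_mem_nhds ha0)] with n hn
      have hsn : Icc a t₁ ⊆ Icc (s n) t₁ := Icc_subset_Icc_left hn.le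
      refine ⟨fun u hu => ?_, fun u hu => ⟨hy0 n u hu.2, ?_⟩⟩
      · have e := hyz n u (hsn hu).1
        rw [e]
        exact ((hz n u (hsn hu)).mono hsn).congr (fun v hv => hyz n v (hsn hv).1) e
      · linarith [hyM n u (hsub hu), hu.2]
  refine ⟨ζ, hderiv, fun t ht' => ?_, ?_⟩
  · refine lt_of_le_of_ne (hζ0 t ht') fun h0 => ?_
    have hd := hderiv t ht'
    rw [← h0] at hd
    have hd2 := hd.mono (t := Ioc t₀ t₁) (s := Ioo t₀ t) fun u hu => ⟨hu.1, hu.2.le.trans ht'.2⟩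
    rw [hasDerivWithinAt_iff_tendsto_slope' (by simp)] at hd2
    haveI : (𝓝[Ioo t₀ t] t).NeBot := by
      rw [nhdsWithin_Ioo_eq_nhdsLT ht'.1]; infer_instance
    have : (1 - (k t)^2 * 0^2 : ℝ) ≤ 0 := by
      refine le_of_tendsto hd2 ?_
      filter_upwards [self_mem_nhdsWithin] with u hu
      rw [slope_def_field, ← h0]
      refine div_nonpos_of_nonneg_of_nonpos ?_ ?_
      · simpa using hζ0 u ⟨hu.1, hu.2.le.trans ht'.2⟩
      · linarith [hu.2]
    norm_num at this
  · have h1 : Tendsto (fun t => t - t₀) (𝓝[>] t₀) (𝓝 0) := by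
      have : Tendsto (fun t => t - t₀) (𝓝 t₀) (𝓝 (t₀ - t₀)) :=
        (continuous_id.sub continuous_const).tendsto t₀
      rw [sub_self] at this
      exact this.mono_left nhdsWithin_le_nhds
    have hev : ∀ᶠ t in 𝓝[>] t₀, t ∈ Ioc t₀ t₁ := Ioc_mem_nhdsGT ht
    exact squeeze_zero' (hev.mono hζ0) (hev.mono hζM) h1
end

section
/- Uniqueness of unstable Riccati solutions: Let t₀ < t₁ be real numbers and let k : (t₀,t₁] → ℝ be a C¹ function with k(t) > 0 for all t ∈ (t₀,t₁] and k(t) → +∞ as t → t₀⁺. If ζ and η are two differentiable functions on (t₀,t₁] that both satisfy the equation ζ'(t) = 1 − k(t)²ζ(t)² on (t₀,t₁], are both positive on (t₀,t₁], and both tend to 0 as t → t₀⁺, then ζ(t) = η(t) for all t ∈ (t₀,t₁]. -/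
/-- An *unstable solution* of the Riccati equation `ζ' = 1 - k²ζ²` on `(t₀,t₁]`:
a solution `ζ` with `ζ > 0` on `(t₀,t₁]` and `ζ(t) → 0` as `t → t₀⁺`. -/
def IsUnstableRiccatiSolution (t₀ t₁ : ℝ) (k ζ : ℝ → ℝ) : Prop :=
  (∀ t ∈ Set.Ioc t₀ t₁,
    HasDerivWithinAt ζ (1 - (k t) ^ 2 * (ζ t) ^ 2) (Set.Ioc t₀ t₁) t) ∧
  (∀ t ∈ Set.Ioc t₀ t₁, 0 < ζ t) ∧
  Filter.Tendsto ζ (nhdsWithin t₀ (Set.Ioi t₀)) (nhds 0)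

/-- **Uniqueness of unstable Riccati solutions.**
Let `t₀ < t₁` and let `k : (t₀,t₁] → ℝ` be `C¹` with `k > 0` and `k(t) → +∞`
as `t → t₀⁺`.  If `ζ` and `η` are differentiable on `(t₀,t₁]`, both satisfy
`ζ' = 1 - k²ζ²`, both are positive on `(t₀,t₁]`, and both tend to `0` as
`t → t₀⁺`, then `ζ = η` on `(t₀,t₁]`. -/
theorem unstable_riccati_unique
    (t₀ t₁ : ℝ) (ht : t₀ < t₁)
    (k : ℝ → ℝ)
    (hk : ContDiffOn ℝ 1 k (Set.Ioc t₀ t₁))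
    (hkpos : ∀ t ∈ Set.Ioc t₀ t₁, 0 < k t)
    (hktop : Filter.Tendsto k (nhdsWithin t₀ (Set.Ioi t₀)) Filter.atTop)
    (ζ η : ℝ → ℝ)
    (hζ : IsUnstableRiccatiSolution t₀ t₁ k ζ)
    (hη : IsUnstableRiccatiSolution t₀ t₁ k η) :
    ∀ t ∈ Set.Ioc t₀ t₁, ζ t = η t := by
  obtain ⟨hζd, hζp, hζl⟩ := hζ
  obtain ⟨hηd, hηp, hηl⟩ := hη
  have hd : ∀ t ∈ Set.Ioc t₀ t₁, HasDerivWithinAt (fun s => (ζ s - η s) ^ 2)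
      (-(2 * (k t) ^ 2 * (ζ t + η t) * (ζ t - η t) ^ 2)) (Set.Ioc t₀ t₁) t := by
    intro t h
    have := ((hζd t h).sub (hηd t h)).pow 2
    refine this.congr_deriv ?_
    simp only [Pi.sub_apply]
    push_cast
    ring
  have hanti : AntitoneOn (fun s => (ζ s - η s) ^ 2) (Set.Ioc t₀ t₁) := by
    refine antitoneOn_of_hasDerivWithinAt_nonpos (convex_Ioc t₀ t₁)
      (f' := fun t => -(2 * (k t) ^ 2 * (ζ t + η t) * (ζ t - η t) ^ 2))
      (fun t h => (hd t h).continuousWithinAt)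
      (fun t h => (hd t (interior_subset h)).mono interior_subset) ?_
    intro t h
    have h1 := hζp t (interior_subset h)
    have h2 := hηp t (interior_subset h)
    have : 0 ≤ 2 * (k t) ^ 2 * (ζ t + η t) * (ζ t - η t) ^ 2 := by positivity
    simpa using this
  have hlim : Filter.Tendsto (fun s => (ζ s - η s) ^ 2) (nhdsWithin t₀ (Set.Ioi t₀))
      (nhds 0) := by
    simpa using (hζl.sub hηl).pow 2
  intro t h
  have hle : (ζ t - η t) ^ 2 ≤ 0 := by
    refine ge_of_tendsto hlim ?_
    filter_upwards [Ioo_mem_nhdsGT h.1] with s hs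
    exact hanti ⟨hs.1, hs.2.le.trans h.2⟩ h hs.2.le
  have h0 : ζ t - η t = 0 := pow_eq_zero_iff (two_ne_zero) |>.1 (le_antisymm hle (sq_nonneg _))
  linarith
end

section
/- Bound on unstable Riccati solutions: Let t₀ < t₁ be real numbers and let k : (t₀,t₁] → ℝ be a C¹ function with k(t) > 0 for all t ∈ (t₀,t₁] and k(t) → +∞ as t → t₀⁺. Let ζ : (t₀,t₁] → ℝ be an unstable solution of ζ' = 1 − k²ζ². If u̲ : (t₀,t₁] → ℝ is any C¹ function with u̲(t) > 0, u̲'(t) < 0, and u̲(t) ≤ k(t) for all t ∈ (t₀,t₁], then ζ(t) ≤ 1/u̲(t) for all t ∈ (t₀,t₁]. -/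
/-- **Bound on unstable Riccati solutions.**
Let `t₀ < t₁` and let `k : (t₀,t₁] → ℝ` be `C¹` with `k > 0` and `k(t) → +∞`
as `t → t₀⁺`, and let `ζ` be an unstable solution of `ζ' = 1 - k²ζ²`.
If `u̲ : (t₀,t₁] → ℝ` is `C¹` with `u̲ > 0`, `u̲' < 0`, and `u̲ ≤ k` on `(t₀,t₁]`,
then `ζ(t) ≤ 1/u̲(t)` on `(t₀,t₁]`. -/
theorem unstable_riccati_bound
    (t₀ t₁ : ℝ) (ht : t₀ < t₁)
    (k : ℝ → ℝ)
    (hk : ContDiffOn ℝ 1 k (Set.Ioc t₀ t₁))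
    (hkpos : ∀ t ∈ Set.Ioc t₀ t₁, 0 < k t)
    (hktop : Filter.Tendsto k (nhdsWithin t₀ (Set.Ioi t₀)) Filter.atTop)
    (ζ : ℝ → ℝ)
    (hζ : IsUnstableRiccatiSolution t₀ t₁ k ζ)
    (u u' : ℝ → ℝ)
    (hu : ∀ t ∈ Set.Ioc t₀ t₁, HasDerivWithinAt u (u' t) (Set.Ioc t₀ t₁) t)
    (hu'cont : ContinuousOn u' (Set.Ioc t₀ t₁))
    (hupos : ∀ t ∈ Set.Ioc t₀ t₁, 0 < u t)
    (hu'neg : ∀ t ∈ Set.Ioc t₀ t₁, u' t < 0)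
    (huk : ∀ t ∈ Set.Ioc t₀ t₁, u t ≤ k t) :
    ∀ t ∈ Set.Ioc t₀ t₁, ζ t ≤ 1 / u t := by
  obtain ⟨hd, hpos, hlim⟩ := hζ
  intro T hT
  by_contra hcon
  have hgt : 1 / u T < ζ T := not_le.mp hcon
  have huT := hupos T hT
  have hw : 1 < ζ T * u T := by rwa [div_lt_iff₀ huT] at hgt
  -- a point `a` in `(t₀, T)` with `ζ a < ζ T`
  have h1 : ∀ᶠ x in nhdsWithin t₀ (Set.Ioi t₀), ζ x < ζ T :=
    hlim.eventually (gt_mem_nhds (hpos T hT))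
  have h2 : ∀ᶠ x in nhdsWithin t₀ (Set.Ioi t₀), x ∈ Set.Ioo t₀ T :=
    Ioo_mem_nhdsGT hT.1
  obtain ⟨a, haT, ha⟩ := (h1.and h2).exists
  have hsub : Set.Icc a T ⊆ Set.Ioc t₀ t₁ := fun x hx =>
    ⟨ha.1.trans_le hx.1, hx.2.trans hT.2⟩
  have hc : ContinuousOn ζ (Set.Icc a T) := fun x hx =>
    ((hd x (hsub hx)).continuousWithinAt).mono hsub
  obtain ⟨m, hm, hmax⟩ := isCompact_Icc.exists_isMaxOn (Set.nonempty_Icc.2 ha.2.le) hc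
  have hmT : ζ T ≤ ζ m := hmax (Set.right_mem_Icc.2 ha.2.le)
  have ham : a < m := by
    rcases hm.1.eq_or_lt with h | h
    · rw [← h] at hmT
      linarith
    · exact h
  -- `u` is antitone
  have hanti : AntitoneOn u (Set.Ioc t₀ t₁) := by
    refine antitoneOn_of_hasDerivWithinAt_nonpos (f' := u') (convex_Ioc t₀ t₁)
      (fun x hx => (hu x hx).continuousWithinAt) ?_ ?_
    · intro x hx
      exact (hu x (interior_subset hx)).mono interior_subset
    · intro x hx
      exact (hu'neg x (interior_subset hx)).le
  have hum : u T ≤ u m := hanti (hsub hm) hT hm.2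
  have hζm := hpos m (hsub hm)
  have hkm : 1 < k m * ζ m := by
    have h3 : u T * ζ T ≤ k m * ζ m :=
      mul_le_mul (hum.trans (huk m (hsub hm))) hmT (hpos T hT).le (hkpos m (hsub hm)).le
    linarith [mul_comm (u T) (ζ T)]
  have hneg : 1 - (k m) ^ 2 * (ζ m) ^ 2 < 0 := by nlinarith
  -- one-sided derivative from the left
  have hder := (hd m (hsub hm)).mono
    (show Set.Ico a m ⊆ Set.Ioc t₀ t₁ from fun x hx => hsub ⟨hx.1, hx.2.le.trans hm.2⟩)
  rw [hasDerivWithinAt_iff_tendsto_slope' (by simp)] at hder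
  have hne : (nhdsWithin m (Set.Ico a m)).NeBot := by
    rw [nhdsWithin_Ico_eq_nhdsLT ham]
    infer_instance
  have h4 := hder.eventually (gt_mem_nhds hneg)
  obtain ⟨x, hx, hxm⟩ := (h4.and self_mem_nhdsWithin).exists
  have h5 : ζ x ≤ ζ m := hmax ⟨hxm.1, hxm.2.le.trans hm.2⟩
  rw [slope_def_field] at hx
  have h6 : 0 ≤ (ζ x - ζ m) / (x - m) :=
    div_nonneg_of_nonpos (by linarith) (by linarith [hxm.2])
  linarith
end

section
/- Comparison of unstable Riccati solutions: Let t₀ < t₁ be real numbers. For i = 1,2, let kᵢ : (t₀,t₁] → ℝ be a C¹ function with kᵢ(t) > 0 for all t and kᵢ(t) → +∞ as t → t₀⁺, and let ζᵢ : (t₀,t₁] → ℝ be an unstable solution of ζᵢ' = 1 − kᵢ²ζᵢ². If k₁(t) ≥ k₂(t) for all t ∈ (t₀,t₁], then ζ₁(t) ≤ ζ₂(t) for all t ∈ (t₀,t₁]. -/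
/-- **Comparison of unstable Riccati solutions.**
Let `t₀ < t₁`.  For `i = 1,2` let `kᵢ : (t₀,t₁] → ℝ` be `C¹`, positive, with
`kᵢ(t) → +∞` as `t → t₀⁺`, and let `ζᵢ` be an unstable solution of
`ζᵢ' = 1 - kᵢ²ζᵢ²`.  If `k₁ ≥ k₂` on `(t₀,t₁]`, then `ζ₁ ≤ ζ₂` on `(t₀,t₁]`. -/
theorem unstable_riccati_comparison
    (t₀ t₁ : ℝ) (ht : t₀ < t₁)
    (k₁ k₂ : ℝ → ℝ)
    (hk₁ : ContDiffOn ℝ 1 k₁ (Set.Ioc t₀ t₁))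
    (hk₂ : ContDiffOn ℝ 1 k₂ (Set.Ioc t₀ t₁))
    (hk₁pos : ∀ t ∈ Set.Ioc t₀ t₁, 0 < k₁ t)
    (hk₂pos : ∀ t ∈ Set.Ioc t₀ t₁, 0 < k₂ t)
    (hk₁top : Filter.Tendsto k₁ (nhdsWithin t₀ (Set.Ioi t₀)) Filter.atTop)
    (hk₂top : Filter.Tendsto k₂ (nhdsWithin t₀ (Set.Ioi t₀)) Filter.atTop)
    (ζ₁ ζ₂ : ℝ → ℝ)
    (hζ₁ : IsUnstableRiccatiSolution t₀ t₁ k₁ ζ₁)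
    (hζ₂ : IsUnstableRiccatiSolution t₀ t₁ k₂ ζ₂)
    (hk : ∀ t ∈ Set.Ioc t₀ t₁, k₂ t ≤ k₁ t) :
    ∀ t ∈ Set.Ioc t₀ t₁, ζ₁ t ≤ ζ₂ t := by
  obtain ⟨hd₁, hp₁, hl₁⟩ := hζ₁
  obtain ⟨hd₂, hp₂, hl₂⟩ := hζ₂
  intro s hs
  by_contra hcon
  have hw : 0 < ζ₁ s - ζ₂ s := by linarith [not_le.mp hcon]
  obtain ⟨c, hc⟩ : ∃ c, c = ζ₁ s - ζ₂ s := ⟨_, rfl⟩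
  rw [← hc] at hw
  have hlim : Filter.Tendsto (fun t => ζ₁ t - ζ₂ t) (nhdsWithin t₀ (Set.Ioi t₀)) (nhds 0) := by
    simpa using hl₁.sub hl₂
  have h1 : ∀ᶠ t in nhdsWithin t₀ (Set.Ioi t₀), ζ₁ t - ζ₂ t < c / 2 :=
    hlim.eventually (gt_mem_nhds (by linarith))
  have h2 : ∀ᶠ t in nhdsWithin t₀ (Set.Ioi t₀), t ∈ Set.Ioo t₀ s :=
    Ioo_mem_nhdsGT hs.1
  obtain ⟨a, ha, hat, has⟩ := (h1.and h2).exists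
  have hsa : 0 < s - a := by linarith
  have hd : ∀ t ∈ Set.Ioc t₀ t₁, HasDerivWithinAt (fun t => ζ₁ t - ζ₂ t)
      ((1 - (k₁ t) ^ 2 * (ζ₁ t) ^ 2) - (1 - (k₂ t) ^ 2 * (ζ₂ t) ^ 2)) (Set.Ioc t₀ t₁) t :=
    fun t h => (hd₁ t h).sub (hd₂ t h)
  have hs1 := hs.2
  have key := image_le_of_deriv_right_lt_deriv_boundary
    (f := fun t => ζ₁ t - ζ₂ t)
    (f' := fun t => (1 - (k₁ t) ^ 2 * (ζ₁ t) ^ 2) - (1 - (k₂ t) ^ 2 * (ζ₂ t) ^ 2))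
    (a := a) (b := s)
    (B := fun x => c / 2 + c / 4 / (s - a) * (x - a)) (B' := fun _ => c / 4 / (s - a))
    (fun t h => ((hd t ⟨by linarith [h.1], by linarith [h.2]⟩).continuousWithinAt).mono
      (fun x hx => ⟨by linarith [hx.1], by linarith [hx.2]⟩))
    (fun t h => by
      refine (hd t ⟨by linarith [h.1], by linarith [h.2]⟩).mono_of_mem_nhdsWithin ?_
      refine Filter.mem_of_superset (Icc_mem_nhdsGE h.2) ?_
      exact fun x hx => ⟨by linarith [hx.1, h.1], by linarith [hx.2]⟩)
    (by simpa using ha.le)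
    (fun x => by
      simpa using (((hasDerivAt_id x).sub_const a).const_mul (c / 4 / (s - a))).const_add (c / 2))
    (fun x hx he => by
      have hxm : x ∈ Set.Ioc t₀ t₁ := ⟨by linarith [hx.1], by linarith [hx.2]⟩
      have hq : 0 < c / 4 / (s - a) := by positivity
      have hB : 0 ≤ c / 4 / (s - a) * (x - a) := mul_nonneg hq.le (by linarith [hx.1])
      have hz : ζ₂ x ≤ ζ₁ x := by
        linarith
      have e1 : k₂ x * ζ₂ x ≤ k₁ x * ζ₁ x :=
        mul_le_mul (hk x hxm) hz (hp₂ x hxm).le (hk₁pos x hxm).le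
      have e2 : 0 < k₂ x * ζ₂ x := mul_pos (hk₂pos x hxm) (hp₂ x hxm)
      have e3 : (k₂ x * ζ₂ x) ^ 2 ≤ (k₁ x * ζ₁ x) ^ 2 := pow_le_pow_left₀ e2.le e1 2
      rw [mul_pow, mul_pow] at e3
      linarith)
    (Set.right_mem_Icc.mpr has.le)
  rw [div_mul_cancel₀ _ hsa.ne', ← hc] at key
  linarith
end

section
/- Upper bound for unstable Riccati solutions under a curvature lower bound: Let t₁ > 0, let k : (0,t₁] → ℝ be a C¹ function with k(t) > 0 for all t and k(t) → +∞ as t → 0⁺, and let ζ : (0,t₁] → ℝ be an unstable solution of ζ' = 1 − k²ζ². Let r > 1. If k(t)² ≥ r(r−1)/t² for all t ∈ (0,t₁], then ζ(t) ≤ t/r for all t ∈ (0,t₁]. -/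
/-- **Upper bound for unstable Riccati solutions under a curvature lower bound.**
Let `t₁ > 0`, `k : (0,t₁] → ℝ` be `C¹`, positive, with `k(t) → +∞` as `t → 0⁺`,
and let `ζ` be an unstable solution of `ζ' = 1 - k²ζ²`.  Let `r > 1`.  If
`k(t)² ≥ r(r-1)/t²` on `(0,t₁]`, then `ζ(t) ≤ t/r` on `(0,t₁]`. -/
theorem unstable_riccati_upper_bound
    (t₁ : ℝ) (ht₁ : 0 < t₁)
    (k : ℝ → ℝ)
    (hk : ContDiffOn ℝ 1 k (Set.Ioc 0 t₁))
    (hkpos : ∀ t ∈ Set.Ioc (0:ℝ) t₁, 0 < k t)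
    (hktop : Filter.Tendsto k (nhdsWithin 0 (Set.Ioi 0)) Filter.atTop)
    (ζ : ℝ → ℝ)
    (hζ : IsUnstableRiccatiSolution 0 t₁ k ζ)
    (r : ℝ) (hr : 1 < r)
    (hkb : ∀ t ∈ Set.Ioc (0:ℝ) t₁, r * (r - 1) / t ^ 2 ≤ (k t) ^ 2) :
    ∀ t ∈ Set.Ioc (0:ℝ) t₁, ζ t ≤ t / r := by
  obtain ⟨hd, -, hlim⟩ := hζ
  intro s hs
  by_contra! hcon
  have hr0 : 0 < r := by linarith
  set d : ℝ → ℝ := fun t => ζ t - t / r with hddef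
  have hds : 0 < d s := by simp only [hddef]; linarith
  have hdd : ∀ t ∈ Set.Ioc (0:ℝ) t₁,
      HasDerivWithinAt d (1 - (k t) ^ 2 * (ζ t) ^ 2 - 1 / r) (Set.Ioc 0 t₁) t := by
    intro t ht
    exact (hd t ht).sub ((hasDerivWithinAt_id t _).div_const r)
  have hdlim : Filter.Tendsto d (nhdsWithin 0 (Set.Ioi 0)) (nhds 0) := by
    have h1 : Filter.Tendsto (fun t : ℝ => t / r) (nhdsWithin 0 (Set.Ioi 0)) (nhds 0) := by
      have h2 : Continuous (fun t : ℝ => t / r) := by fun_prop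
      have h3 := h2.tendsto 0
      simp only [zero_div] at h3
      exact h3.mono_left nhdsWithin_le_nhds
    simpa using hlim.sub h1
  obtain ⟨a, hda, ha0, has⟩ : ∃ a, d a < d s ∧ 0 < a ∧ a < s := by
    have h1 : ∀ᶠ t in nhdsWithin (0:ℝ) (Set.Ioi 0), d t < d s :=
      hdlim.eventually (gt_mem_nhds hds)
    have h2 : ∀ᶠ t in nhdsWithin (0:ℝ) (Set.Ioi 0), t ∈ Set.Ioo 0 s :=
      Ioo_mem_nhdsGT hs.1
    obtain ⟨a, h⟩ := (h1.and h2).exists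
    exact ⟨a, h.1, h.2.1, h.2.2⟩
  have hsub : Set.Icc a s ⊆ Set.Ioc 0 t₁ := fun t ht =>
    ⟨lt_of_lt_of_le ha0 ht.1, ht.2.trans hs.2⟩
  have hcont : ContinuousOn d (Set.Icc a s) := fun t ht =>
    ((hdd t (hsub ht)).continuousWithinAt).mono hsub
  obtain ⟨m, hm, hmax⟩ := isCompact_Icc.exists_isMaxOn ⟨s, has.le, le_rfl⟩ hcont
  have hdm : d s ≤ d m := hmax ⟨has.le, le_rfl⟩
  have ham : a < m := by
    rcases hm.1.eq_or_lt with h | h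
    · rw [← h] at hdm; linarith
    · exact h
  have hm0 : 0 < m := ha0.trans ham
  have hder := (hdd m (hsub hm)).mono
    (show Set.Ioo a m ⊆ Set.Ioc 0 t₁ from fun t ht => hsub ⟨ht.1.le, ht.2.le.trans hm.2⟩)
  rw [hasDerivWithinAt_iff_tendsto_slope' (by simp)] at hder
  have hne : (nhdsWithin m (Set.Ioo a m)).NeBot := by
    rw [nhdsWithin_Ioo_eq_nhdsLT ham]; infer_instance
  have hge : 0 ≤ 1 - (k m) ^ 2 * (ζ m) ^ 2 - 1 / r := by
    refine ge_of_tendsto hder ?_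
    filter_upwards [self_mem_nhdsWithin] with t ht
    have h1 : d t ≤ d m := hmax ⟨ht.1.le, ht.2.le.trans hm.2⟩
    rw [slope_def_field]
    exact div_nonneg_of_nonpos (by linarith) (by linarith [ht.2])
  have hζm : m / r < ζ m := by
    have : 0 < d m := lt_of_lt_of_le hds hdm
    simp only [hddef] at this
    linarith
  have hsq : (m / r) ^ 2 < (ζ m) ^ 2 := by
    have : 0 < m / r := by positivity
    gcongr
  have hc : 0 < r * (r - 1) / m ^ 2 := by
    have : 0 < r - 1 := by linarith
    positivity
  have h1 : r * (r - 1) / m ^ 2 * (m / r) ^ 2 < (k m) ^ 2 * (ζ m) ^ 2 :=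
    (mul_lt_mul_of_pos_left hsq hc).trans_le
      (mul_le_mul_of_nonneg_right (hkb m (hsub hm)) (sq_nonneg _))
  have h2 : r * (r - 1) / m ^ 2 * (m / r) ^ 2 = 1 - 1 / r := by
    field_simp
  linarith
end

section
/- Lower bound for unstable Riccati solutions under a curvature upper bound: Let t₁ > 0, let k : (0,t₁] → ℝ be a C¹ function with k(t) > 0 for all t and k(t) → +∞ as t → 0⁺, and let ζ : (0,t₁] → ℝ be an unstable solution of ζ' = 1 − k²ζ². Let r > 1. If k(t)² ≤ r(r−1)/t² for all t ∈ (0,t₁], then ζ(t) ≥ t/r for all t ∈ (0,t₁]. -/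
/-- **Lower bound for unstable Riccati solutions under a curvature upper bound.**
Let `t₁ > 0`, `k : (0,t₁] → ℝ` be `C¹`, positive, with `k(t) → +∞` as `t → 0⁺`,
and let `ζ` be an unstable solution of `ζ' = 1 - k²ζ²`.  Let `r > 1`.  If
`k(t)² ≤ r(r-1)/t²` on `(0,t₁]`, then `ζ(t) ≥ t/r` on `(0,t₁]`. -/
theorem unstable_riccati_lower_bound
    (t₁ : ℝ) (ht₁ : 0 < t₁)
    (k : ℝ → ℝ)
    (hk : ContDiffOn ℝ 1 k (Set.Ioc 0 t₁))
    (hkpos : ∀ t ∈ Set.Ioc (0:ℝ) t₁, 0 < k t)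
    (hktop : Filter.Tendsto k (nhdsWithin 0 (Set.Ioi 0)) Filter.atTop)
    (ζ : ℝ → ℝ)
    (hζ : IsUnstableRiccatiSolution 0 t₁ k ζ)
    (r : ℝ) (hr : 1 < r)
    (hkb : ∀ t ∈ Set.Ioc (0:ℝ) t₁, (k t) ^ 2 ≤ r * (r - 1) / t ^ 2) :
    ∀ t ∈ Set.Ioc (0:ℝ) t₁, t / r ≤ ζ t := by
  obtain ⟨hd, hpos, hlim⟩ := hζ
  intro T hT
  by_contra hcon
  have hcon : ζ T < T / r := not_le.mp hcon
  have hr0 : 0 < r := by linarith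
  set w : ℝ → ℝ := fun t => ζ t - t / r with hw
  have hwT : w T < 0 := by simp only [hw]; linarith
  have hwl : Filter.Tendsto w (nhdsWithin 0 (Set.Ioi 0)) (nhds 0) := by
    have h1 : Filter.Tendsto (fun t : ℝ => t / r) (nhdsWithin 0 (Set.Ioi 0)) (nhds (0 / r)) :=
      ((continuous_id.div_const r).tendsto 0).mono_left nhdsWithin_le_nhds
    simpa using hlim.sub h1
  have hwc : ContinuousOn w (Set.Ioc 0 t₁) := by
    apply ContinuousOn.sub
    · exact fun t ht => (hd t ht).continuousWithinAt
    · exact (continuous_id.div_const r).continuousOn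
  have hev : ∀ᶠ t in nhdsWithin (0:ℝ) (Set.Ioi 0), w T / 2 < w t :=
    hwl.eventually (lt_mem_nhds (by linarith))
  have hev2 : ∀ᶠ t in nhdsWithin (0:ℝ) (Set.Ioi 0), t ∈ Set.Ioo 0 T :=
    Ioo_mem_nhdsGT hT.1
  obtain ⟨s, hs, hsT⟩ := (hev.and hev2).exists
  have hsub : Set.Icc s T ⊆ Set.Ioc 0 t₁ := fun x hx =>
    ⟨lt_of_lt_of_le hsT.1 hx.1, hx.2.trans hT.2⟩
  have hcl : IsClosed (Set.Icc s T ∩ w ⁻¹' Set.Ici (w T / 2)) :=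
    (hwc.mono hsub).preimage_isClosed_of_isClosed isClosed_Icc isClosed_Ici
  have hcomp : IsCompact (Set.Icc s T ∩ w ⁻¹' Set.Ici (w T / 2)) :=
    isCompact_Icc.of_isClosed_subset hcl Set.inter_subset_left
  obtain ⟨c, hc, hmax⟩ := hcomp.exists_isGreatest ⟨s, ⟨le_rfl, hsT.2.le⟩, hs.le⟩
  have hcw : w T / 2 ≤ w c := hc.2
  have hcs : Set.Icc c T ⊆ Set.Icc s T := Set.Icc_subset_Icc_left hc.1.1
  have hmono : MonotoneOn w (Set.Icc c T) := by
    apply monotoneOn_of_hasDerivWithinAt_nonneg (convex_Icc c T) (hwc.mono (hcs.trans hsub))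
      (f' := fun t => 1 - (k t) ^ 2 * (ζ t) ^ 2 - 1 / r)
    · intro x hx
      have hx' := hsub (hcs (interior_subset hx))
      exact ((hd x hx').sub ((hasDerivWithinAt_id x _).div_const r)).mono
        ((interior_subset).trans (hcs.trans hsub))
    · intro x hx
      have hx' := hsub (hcs (interior_subset hx))
      rw [interior_Icc] at hx
      have hwx : w x < w T / 2 := by
        by_contra h
        have := hmax ⟨⟨hc.1.1.trans hx.1.le, hx.2.le⟩, not_lt.mp h⟩
        linarith [hx.1]
      have hz : ζ x ≤ x / r := by
        have : ζ x - x / r < w T / 2 := hwx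
        linarith
      have hz0 := hpos x hx'
      have hx0 : 0 < x := hx'.1
      have h2 : (ζ x) ^ 2 ≤ (x / r) ^ 2 := by gcongr
      have h3 : (k x) ^ 2 * (ζ x) ^ 2 ≤ r * (r - 1) / x ^ 2 * (x / r) ^ 2 :=
        mul_le_mul (hkb x hx') h2 (sq_nonneg _) ((sq_nonneg _).trans (hkb x hx'))
      have h4 : r * (r - 1) / x ^ 2 * (x / r) ^ 2 = 1 - 1 / r := by
        field_simp
      show 0 ≤ 1 - (k x) ^ 2 * (ζ x) ^ 2 - 1 / r
      linarith
  have := hmono ⟨le_rfl, hc.1.2⟩ ⟨hc.1.2, le_rfl⟩ hc.1.2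
  linarith
end

section
/- Second-order asymptotics of unstable Riccati solutions: Let t₁ > 0, let k : (0,t₁] → ℝ be a C¹ function with k(t) > 0 for all t and k(t) → +∞ as t → 0⁺, and let ζ : (0,t₁] → ℝ be an unstable solution of ζ' = 1 − k²ζ². Let r > 1, N > 0, and 0 < t₂ < min{t₁, (r−1)/N}. If r(r−1)/t² − N/t ≤ k(t)² ≤ r(r−1)/t² + N/t for all t ∈ (0,t₂], then there exists M > 0 such that t/r − Mt² ≤ ζ(t) ≤ t/r + Mt² for all t ∈ (0,t₂]. -/
lemma riccati_aux (T : ℝ) (f f' G G' : ℝ → ℝ)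
    (hf : ∀ t ∈ Set.Ioc (0:ℝ) T, HasDerivAt f (f' t) t)
    (hf0 : Filter.Tendsto f (nhdsWithin 0 (Set.Ioi 0)) (nhds 0))
    (hG : ∀ t, HasDerivAt G (G' t) t)
    (hGpos : ∀ t, 0 < t → 0 ≤ G t)
    (hlt : ∀ ε > 0, ∀ t ∈ Set.Ioc (0:ℝ) T, f t = G t + ε → f' t < G' t) :
    ∀ t ∈ Set.Ioc (0:ℝ) T, f t ≤ G t := by
  intro t ht
  refine le_of_forall_pos_le_add fun ε hε => ?_
  have h1 : ∀ᶠ s in nhdsWithin (0:ℝ) (Set.Ioi 0), f s < ε := hf0.eventually_lt_const hε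
  have h2 : ∀ᶠ s in nhdsWithin (0:ℝ) (Set.Ioi 0), s ∈ Set.Ioo (0:ℝ) t :=
    Ioo_mem_nhdsGT ht.1
  obtain ⟨a, ha1, ha2⟩ := (h1.and h2).exists
  have hsub : ∀ x ∈ Set.Icc a t, x ∈ Set.Ioc (0:ℝ) T := fun x hx =>
    ⟨ha2.1.trans_le hx.1, hx.2.trans ht.2⟩
  refine image_le_of_deriv_right_lt_deriv_boundary' (f := f) (f' := f') (a := a) (b := t)
    (B := fun x => G x + ε) (B' := G') ?_ ?_ ?_ ?_ ?_ ?_ (Set.right_mem_Icc.2 ha2.2.le)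
  · exact fun x hx => (hf x (hsub x hx)).continuousAt.continuousWithinAt
  · exact fun x hx => (hf x (hsub x (Set.Ico_subset_Icc_self hx))).hasDerivWithinAt
  · have := hGpos a ha2.1
    show f a ≤ G a + ε
    linarith
  · exact fun x hx => ((hG x).add_const ε).continuousAt.continuousWithinAt
  · exact fun x hx => ((hG x).add_const ε).hasDerivWithinAt
  · exact fun x hx => hlt ε hε x (hsub x (Set.Ico_subset_Icc_self hx))

/-- **Second-order asymptotics of unstable Riccati solutions.**
Let `t₁ > 0`, `k : (0,t₁] → ℝ` be `C¹`, positive, with `k(t) → +∞` as `t → 0⁺`,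
and let `ζ` be an unstable solution of `ζ' = 1 - k²ζ²`.  Let `r > 1`, `N > 0`
and `0 < t₂ < min {t₁, (r-1)/N}`.  If
`r(r-1)/t² - N/t ≤ k(t)² ≤ r(r-1)/t² + N/t` on `(0,t₂]`, then there is `M > 0`
with `t/r - Mt² ≤ ζ(t) ≤ t/r + Mt²` on `(0,t₂]`. -/
theorem unstable_riccati_asymptotics
    (t₁ : ℝ) (ht₁ : 0 < t₁)
    (k : ℝ → ℝ)
    (hk : ContDiffOn ℝ 1 k (Set.Ioc 0 t₁))
    (hkpos : ∀ t ∈ Set.Ioc (0:ℝ) t₁, 0 < k t)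
    (hktop : Filter.Tendsto k (nhdsWithin 0 (Set.Ioi 0)) Filter.atTop)
    (ζ : ℝ → ℝ)
    (hζ : IsUnstableRiccatiSolution 0 t₁ k ζ)
    (r N t₂ : ℝ) (hr : 1 < r) (hN : 0 < N)
    (ht₂ : 0 < t₂) (ht₂' : t₂ < min t₁ ((r - 1) / N))
    (hkb : ∀ t ∈ Set.Ioc (0:ℝ) t₂,
      r * (r - 1) / t ^ 2 - N / t ≤ (k t) ^ 2 ∧
      (k t) ^ 2 ≤ r * (r - 1) / t ^ 2 + N / t) :
    ∃ M > 0, ∀ t ∈ Set.Ioc (0:ℝ) t₂,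
      t / r - M * t ^ 2 ≤ ζ t ∧ ζ t ≤ t / r + M * t ^ 2 := by
  obtain ⟨hd, hpos, h0⟩ := hζ
  have hT : t₂ < t₁ := ht₂'.trans_le (min_le_left _ _)
  have hin : ∀ t ∈ Set.Ioc (0:ℝ) t₂, t ∈ Set.Ioc (0:ℝ) t₁ := fun t ht =>
    ⟨ht.1, ht.2.trans hT.le⟩
  have hd' : ∀ t ∈ Set.Ioc (0:ℝ) t₂, HasDerivAt ζ (1 - (k t) ^ 2 * (ζ t) ^ 2) t := fun t ht =>
    (hd t (hin t ht)).hasDerivAt (Ioc_mem_nhds ht.1 (ht.2.trans_lt hT))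
  have hle : ∀ t ∈ Set.Ioc (0:ℝ) t₂, ζ t ≤ t := by
    refine riccati_aux t₂ ζ _ (fun t => t) (fun _ => 1) hd' h0 (fun t => hasDerivAt_id t)
      (fun t ht => ht.le) ?_
    intro ε hε t ht _
    have h1 := hpos t (hin t ht)
    have h2 := hkpos t (hin t ht)
    have : 0 < k t ^ 2 * ζ t ^ 2 := by positivity
    show 1 - k t ^ 2 * ζ t ^ 2 < 1
    linarith
  have hr0 : 0 < r := by linarith
  have hid : Filter.Tendsto (fun t : ℝ => t / r) (nhdsWithin 0 (Set.Ioi 0)) (nhds 0) := by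
    have : Filter.Tendsto (fun t : ℝ => t / r) (nhds 0) (nhds (0 / r)) :=
      (continuous_id.div_const r).tendsto 0
    rw [zero_div] at this
    exact this.mono_left nhdsWithin_le_nhds
  have hG : ∀ t : ℝ, HasDerivAt (fun t => N / 2 * t ^ 2) (N * t) t := fun t => by
    have := (hasDerivAt_pow 2 t).const_mul (N / 2)
    have h2 : N / 2 * (((2:ℕ):ℝ) * t ^ (2 - 1)) = N * t := by
      norm_num
      ring
    rwa [h2] at this
  -- the key identity and bounds
  have key : ∀ t ∈ Set.Ioc (0:ℝ) t₂, ∃ A e : ℝ, 0 < A ∧ |e| ≤ N * t ∧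
      1 - (k t) ^ 2 * (ζ t) ^ 2 - 1 / r = -A * (ζ t - t / r) - e := by
    intro t ht
    have ht0 := ht.1
    have hz := hpos t (hin t ht)
    have hzt := hle t ht
    refine ⟨r * (r - 1) / t ^ 2 * (ζ t + t / r),
      (k t ^ 2 - r * (r - 1) / t ^ 2) * ζ t ^ 2, ?_, ?_, ?_⟩
    · have : 0 < r - 1 := by linarith
      positivity
    · obtain ⟨hl, hu⟩ := hkb t ht
      have he : |k t ^ 2 - r * (r - 1) / t ^ 2| ≤ N / t := abs_le.2 ⟨by linarith, by linarith⟩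
      rw [abs_mul, abs_of_nonneg (sq_nonneg (ζ t))]
      calc _ ≤ N / t * t ^ 2 := by gcongr
        _ = N * t := by field_simp
    · field_simp
      ring
  refine ⟨N / 2, by positivity, fun t ht => ⟨?_, ?_⟩⟩
  · have := riccati_aux t₂ (fun t => t / r - ζ t)
      (fun t => 1 / r - (1 - (k t) ^ 2 * (ζ t) ^ 2)) (fun t => N / 2 * t ^ 2) (fun t => N * t)
      (fun t ht => ((hasDerivAt_id t).div_const r).sub (hd' t ht))
      (by simpa using hid.sub h0) hG (fun t _ => by positivity) ?_ t ht
    · have h : t / r - ζ t ≤ N / 2 * t ^ 2 := this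
      linarith
    · intro ε hε t ht heq
      obtain ⟨A, e, hA, he, hk'⟩ := key t ht
      have heq' : t / r - ζ t = N / 2 * t ^ 2 + ε := heq
      have h1 : 0 < t / r - ζ t := by rw [heq']; positivity
      have h2 := mul_pos hA h1
      have h3 := abs_le.1 he
      show 1 / r - (1 - (k t) ^ 2 * (ζ t) ^ 2) < N * t
      nlinarith [h3.1, h3.2]
  · have := riccati_aux t₂ (fun t => ζ t - t / r)
      (fun t => (1 - (k t) ^ 2 * (ζ t) ^ 2) - 1 / r) (fun t => N / 2 * t ^ 2) (fun t => N * t)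
      (fun t ht => (hd' t ht).sub ((hasDerivAt_id t).div_const r))
      (by simpa using h0.sub hid) hG (fun t _ => by positivity) ?_ t ht
    · have h : ζ t - t / r ≤ N / 2 * t ^ 2 := this
      linarith
    · intro ε hε t ht heq
      obtain ⟨A, e, hA, he, hk'⟩ := key t ht
      have heq' : ζ t - t / r = N / 2 * t ^ 2 + ε := heq
      have h1 : 0 < ζ t - t / r := by rw [heq']; positivity
      have h2 := mul_pos hA h1
      have h3 := abs_le.1 he
      show (1 - (k t) ^ 2 * (ζ t) ^ 2) - 1 / r < N * t
      nlinarith [h3.1, h3.2]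
end

section
/- The model unstable Riccati solution: Let r > 1 and t₁ > 0. Then the function ζ(t) = t/r solves ζ'(t) = 1 − (r(r−1)/t²)·ζ(t)² on (0,t₁], and it is the unique solution of this equation on (0,t₁] that is positive on (0,t₁] and tends to 0 as t → 0⁺. -/
/-- **The model unstable Riccati solution.**
Let `r > 1` and `t₁ > 0`.  Then `ζ(t) = t/r` solves
`ζ'(t) = 1 - (r(r-1)/t²)ζ(t)²` on `(0,t₁]`, and it is the unique solution of
this equation on `(0,t₁]` that is positive on `(0,t₁]` and tends to `0` as
`t → 0⁺`. -/
theorem model_unstable_riccati_solution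
    (r t₁ : ℝ) (hr : 1 < r) (ht₁ : 0 < t₁) :
    (∀ t ∈ Set.Ioc (0:ℝ) t₁,
      HasDerivWithinAt (fun t : ℝ => t / r)
        (1 - (r * (r - 1) / t ^ 2) * (t / r) ^ 2) (Set.Ioc 0 t₁) t) ∧
    (∀ η : ℝ → ℝ,
      (∀ t ∈ Set.Ioc (0:ℝ) t₁,
        HasDerivWithinAt η
          (1 - (r * (r - 1) / t ^ 2) * (η t) ^ 2) (Set.Ioc 0 t₁) t) →
      (∀ t ∈ Set.Ioc (0:ℝ) t₁, 0 < η t) →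
      Filter.Tendsto η (nhdsWithin 0 (Set.Ioi 0)) (nhds 0) →
      ∀ t ∈ Set.Ioc (0:ℝ) t₁, η t = t / r) := by
  have hr0 : 0 < r := by linarith
  have h1 : ∀ t ∈ Set.Ioc (0:ℝ) t₁,
      HasDerivWithinAt (fun t : ℝ => t / r)
        (1 - (r * (r - 1) / t ^ 2) * (t / r) ^ 2) (Set.Ioc 0 t₁) t := by
    intro t ht
    have h0 : t ≠ 0 := ht.1.ne'
    have h := ((hasDerivAt_id t).div_const r).hasDerivWithinAt (s := Set.Ioc 0 t₁)
    refine h.congr_deriv ?_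
    field_simp
    ring
  refine ⟨h1, ?_⟩
  intro η hη hpos hlim
  have hw : ∀ t ∈ Set.Ioc (0:ℝ) t₁, HasDerivWithinAt (fun t => (η t - t / r) ^ 2)
      (-(2 * (r * (r - 1) / t ^ 2) * (η t - t / r) ^ 2 * (η t + t / r))) (Set.Ioc 0 t₁) t := by
    intro t ht
    refine (((hη t ht).sub (h1 t ht)).pow 2).congr_deriv ?_
    simp
    ring
  have hanti : AntitoneOn (fun t => (η t - t / r) ^ 2) (Set.Ioc 0 t₁) := by
    refine antitoneOn_of_hasDerivWithinAt_nonpos (convex_Ioc 0 t₁)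
      (fun t ht => (hw t ht).continuousWithinAt)
      (fun t ht => (hw t (interior_subset ht)).mono interior_subset) ?_
    intro t ht
    have ht' := interior_subset ht
    have h2 := hpos t ht'
    have h3 := ht'.1
    have h4 : 0 < r - 1 := by linarith
    have : 0 ≤ 2 * (r * (r - 1) / t ^ 2) * (η t - t / r) ^ 2 * (η t + t / r) := by positivity
    linarith
  have hl : Filter.Tendsto (fun t => (η t - t / r) ^ 2) (nhdsWithin 0 (Set.Ioi 0)) (nhds 0) := by
    have h2 : Filter.Tendsto (fun t : ℝ => t / r) (nhdsWithin 0 (Set.Ioi 0)) (nhds (0 / r)) :=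
      (Filter.tendsto_id.div_const r).mono_left nhdsWithin_le_nhds
    simpa using (hlim.sub h2).pow 2
  intro t ht
  have h5 : (η t - t / r) ^ 2 ≤ 0 := by
    refine ge_of_tendsto hl ?_
    filter_upwards [Ioc_mem_nhdsGT ht.1] with s hs
    exact hanti ⟨hs.1, hs.2.trans ht.2⟩ ht hs.2
  have h6 : η t - t / r = 0 := by
    have := le_antisymm h5 (sq_nonneg _)
    exact pow_eq_zero_iff (two_ne_zero) |>.1 this
  linarith
end

section
/- Two-sided linear bounds on a Riccati solution with negative curvature coefficient: Let r > 0, 0 < s < T, and let K : [s,T] → ℝ be continuous with −r²/t² ≤ K(t) ≤ 0 for all t ∈ [s,T]. Let ζ : [s,T] → ℝ be differentiable with ζ'(t) = 1 + K(t)ζ(t)² for all t ∈ [s,T] and ζ(s) = 0. If μ ∈ (0,1] satisfies μ + r²μ² ≤ 1, then μ(t−s) ≤ ζ(t) ≤ (t−s)/μ for all t ∈ [s,T]. -/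
/-- **Two-sided linear bounds on a Riccati solution with negative curvature
coefficient.**  Let `r > 0`, `0 < s < T`, and let `K : [s,T] → ℝ` be continuous
with `-r²/t² ≤ K(t) ≤ 0` on `[s,T]`.  Let `ζ : [s,T] → ℝ` be differentiable
with `ζ'(t) = 1 + K(t)ζ(t)²` on `[s,T]` and `ζ(s) = 0`.  If `μ ∈ (0,1]`
satisfies `μ + r²μ² ≤ 1`, then `μ(t-s) ≤ ζ(t) ≤ (t-s)/μ` on `[s,T]`. -/
theorem riccati_two_sided_linear_bounds
    (r s T : ℝ) (hr : 0 < r) (hs : 0 < s) (hsT : s < T)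
    (K : ℝ → ℝ) (hK : ContinuousOn K (Set.Icc s T))
    (hKb : ∀ t ∈ Set.Icc s T, -r ^ 2 / t ^ 2 ≤ K t ∧ K t ≤ 0)
    (ζ : ℝ → ℝ)
    (hζ : ∀ t ∈ Set.Icc s T,
      HasDerivWithinAt ζ (1 + K t * (ζ t) ^ 2) (Set.Icc s T) t)
    (hζ0 : ζ s = 0)
    (μ : ℝ) (hμ : μ ∈ Set.Ioc (0:ℝ) 1) (hμ' : μ + r ^ 2 * μ ^ 2 ≤ 1) :
    ∀ t ∈ Set.Icc s T, μ * (t - s) ≤ ζ t ∧ ζ t ≤ (t - s) / μ := by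
  obtain ⟨hμ0, hμ1⟩ := hμ
  have hcont : ContinuousOn ζ (Set.Icc s T) := fun t ht => (hζ t ht).continuousWithinAt
  have hright : ∀ t ∈ Set.Ico s T,
      HasDerivWithinAt ζ (1 + K t * (ζ t) ^ 2) (Set.Ici t) t := fun t ht =>
    (hζ t (Set.Ico_subset_Icc_self ht)).mono_of_mem_nhdsWithin (Icc_mem_nhdsGE_of_mem ht)
  have hlin : ∀ c t : ℝ, HasDerivAt (fun t => c * (t - s)) c t := fun c t => by
    simpa using ((hasDerivAt_id t).sub_const s).const_mul c
  intro t ht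
  constructor
  · refine image_le_of_deriv_right_lt_deriv_boundary' (f := fun t => μ * (t - s))
      (f' := fun _ => μ) (B := ζ) (B' := fun t => 1 + K t * (ζ t) ^ 2) (a := s) (b := T)
      (by fun_prop) (fun x _ => (hlin μ x).hasDerivWithinAt) (by simp [hζ0]) hcont hright ?_ ht
    intro x hx hxe
    have hx0 : 0 < x := hs.trans_le hx.1
    have h1 := (hKb x (Set.Ico_subset_Icc_self hx)).1
    have hx2 : 0 < x ^ 2 := by positivity
    rw [div_le_iff₀ hx2] at h1
    have h2 : (x - s) ^ 2 < x ^ 2 := by nlinarith [hx.1]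
    have h3 : 0 < r ^ 2 * μ ^ 2 := by positivity
    have hxe' : ζ x = μ * (x - s) := hxe.symm
    show μ < 1 + K x * ζ x ^ 2
    rw [hxe']
    have h4 : -r ^ 2 * (μ * (x - s)) ^ 2 ≤ K x * x ^ 2 * (μ * (x - s)) ^ 2 :=
      mul_le_mul_of_nonneg_right h1 (sq_nonneg _)
    have h5 : r ^ 2 * μ ^ 2 * (x - s) ^ 2 < r ^ 2 * μ ^ 2 * x ^ 2 :=
      mul_lt_mul_of_pos_left h2 h3
    have h6 : 0 < (r ^ 2 * μ ^ 2 + K x * (μ * (x - s)) ^ 2) * x ^ 2 := by linarith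
    have h7 := pos_of_mul_pos_left h6 hx2.le
    linarith
  · have h : ζ t ≤ 1 * (t - s) := by
      refine image_le_of_deriv_right_le_deriv_boundary (f := ζ)
        (f' := fun t => 1 + K t * (ζ t) ^ 2) (B := fun t => 1 * (t - s)) (B' := fun _ => 1)
        (a := s) (b := T) hcont hright (by simp [hζ0]) (by fun_prop)
        (fun x _ => (hlin 1 x).hasDerivWithinAt) ?_ ht
      intro x hx
      have := (hKb x (Set.Ico_subset_Icc_self hx)).2
      nlinarith [mul_nonneg (neg_nonneg.2 this) (sq_nonneg (ζ x))]
    rw [le_div_iff₀ hμ0]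
    nlinarith [ht.1]
end

section
/- Stability of Riccati solutions under perturbation of the coefficient: Let r > 1, ε ∈ (0,1), and N > 0. Then there exists C > 0 such that the following holds. Let 0 < s' ≤ s < T with (1 + 2/ε)s ≤ T, and let K₁, K₂ : (0,T] → ℝ be continuous functions with −r²/t² ≤ Kᵢ(t) ≤ −(r−1)²/t² for i = 1,2 and |K₁(t) − K₂(t)| ≤ N·s/t³ for all t ∈ (0,T]. Let ζ₁ : [s,T] → ℝ and ζ₂ : [s',T] → ℝ be differentiable with ζᵢ'(t) = 1 + Kᵢ(t)ζᵢ(t)², ζ₁(s) = 0 and ζ₂(s') = 0. Then |ζ₁(t) − ζ₂(t)| ≤ C·s for all t ∈ [(1 + 2/ε)s, T]. -/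
lemma ric_right {f : ℝ → ℝ} {f' a b x : ℝ} (hx : x ∈ Set.Ico a b)
    (h : HasDerivWithinAt f f' (Set.Icc a b) x) : HasDerivWithinAt f f' (Set.Ici x) x := by
  apply h.mono_of_mem_nhdsWithin
  exact Filter.mem_of_superset (Icc_mem_nhdsGE hx.2) (Set.Icc_subset_Icc_left hx.1)

lemma ric_bounds (r s T : ℝ) (K ζ : ℝ → ℝ) (hs : 0 < s)
    (hK : ∀ t ∈ Set.Ioc (0:ℝ) T, -r ^ 2 / t ^ 2 ≤ K t ∧ K t ≤ -(r - 1) ^ 2 / t ^ 2)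
    (hz : ∀ t ∈ Set.Icc s T, HasDerivWithinAt ζ (1 + K t * (ζ t) ^ 2) (Set.Icc s T) t)
    (h0 : ζ s = 0) :
    ∀ t ∈ Set.Icc s T, 1 / (2 + r ^ 2) * (t - s) ≤ ζ t ∧ ζ t ≤ t := by
  have hc : ContinuousOn ζ (Set.Icc s T) := fun t ht => (hz t ht).continuousWithinAt
  intro t ht
  constructor
  · have hcpos : 0 < 1 / (2 + r ^ 2) := by positivity
    have hc1 : 1 / (2 + r ^ 2) * (2 + r ^ 2) = 1 := by field_simp
    set c := 1 / (2 + r ^ 2) with hcdef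
    have key := image_le_of_deriv_right_lt_deriv_boundary' (f := fun t => - ζ t)
      (f' := fun t => -(1 + K t * (ζ t) ^ 2)) (a := s) (b := T)
      (B := fun t => -(c * (t - s))) (B' := fun _ => -(c * 1)) hc.neg
      (fun x hx => (ric_right hx (hz x ⟨hx.1, hx.2.le⟩)).neg) (by simp [h0]) (by fun_prop)
      (fun x hx => (((hasDerivAt_id x).sub_const s).const_mul c).neg.hasDerivWithinAt) ?_ ht
    · simpa using key
    · intro x hx he
      have he' : ζ x = c * (x - s) := by simpa using he
      have hx0 : 0 < x := hs.trans_le hx.1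
      have h1 := (hK x ⟨hx0, hx.2.le⟩).1
      rw [div_le_iff₀ (by positivity)] at h1
      have h2 : K x * (x - s) ^ 2 ≥ - r ^ 2 := by
        by_cases hk : 0 ≤ K x
        · nlinarith [mul_nonneg hk (sq_nonneg (x - s)), sq_nonneg r]
        · have : (x - s) ^ 2 ≤ x ^ 2 := by nlinarith [hx.1]
          nlinarith
      show -(1 + K x * (ζ x) ^ 2) < -(c * 1)
      rw [he']
      have hc2 : c ≤ 1 := by nlinarith [mul_nonneg hcpos.le (sq_nonneg r)]
      have h3 : c ^ 2 * (K x * (x - s) ^ 2) ≥ c ^ 2 * (- r ^ 2) :=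
        mul_le_mul_of_nonneg_left h2 (by positivity)
      have h4 : c ^ 2 * r ^ 2 ≤ c * r ^ 2 := by
        apply mul_le_mul_of_nonneg_right _ (sq_nonneg r)
        nlinarith
      nlinarith
  · have key := image_le_of_deriv_right_le_deriv_boundary (f := ζ)
      (f' := fun t => (1 + K t * (ζ t) ^ 2)) (a := s) (b := T)
      (B := fun t => t) (B' := fun _ => 1) hc
      (fun x hx => (ric_right hx (hz x ⟨hx.1, hx.2.le⟩))) (by simp [h0, hs.le]) (by fun_prop)
      (fun x hx => (hasDerivAt_id x).hasDerivWithinAt) ?_ ht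
    · simpa using key
    · intro x hx
      have hx0 : 0 < x := hs.trans_le hx.1
      have h1 := (hK x ⟨hx0, hx.2.le⟩).2
      have : K x ≤ 0 := h1.trans (by rw [neg_div]; exact neg_nonpos.2 (by positivity))
      nlinarith [mul_nonneg (neg_nonneg.2 this) (sq_nonneg (ζ x))]

lemma ric_diff (q c N B s T : ℝ) (K₁ K₂ ζ₁ ζ₂ : ℝ → ℝ) (hs : 0 < s) (hcpos : 0 < c)
    (hB : 2 ≤ B) (hBN : N < q ^ 2 * c * B)
    (hK : ∀ t ∈ Set.Ioc (0:ℝ) T, K₁ t ≤ -q ^ 2 / t ^ 2)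
    (hKK : ∀ t ∈ Set.Ioc (0:ℝ) T, K₁ t - K₂ t ≤ N * s / t ^ 3)
    (hN : 0 < N)
    (hz₁ : ∀ t ∈ Set.Icc (2 * s) T,
      HasDerivWithinAt ζ₁ (1 + K₁ t * (ζ₁ t) ^ 2) (Set.Icc (2 * s) T) t)
    (hz₂ : ∀ t ∈ Set.Icc (2 * s) T,
      HasDerivWithinAt ζ₂ (1 + K₂ t * (ζ₂ t) ^ 2) (Set.Icc (2 * s) T) t)
    (hb₁ : ∀ t ∈ Set.Icc (2 * s) T, c * (t - s) ≤ ζ₁ t ∧ ζ₁ t ≤ t)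
    (hb₂ : ∀ t ∈ Set.Icc (2 * s) T, c * (t - s) ≤ ζ₂ t ∧ ζ₂ t ≤ t) :
    ∀ t ∈ Set.Icc (2 * s) T, ζ₁ t - ζ₂ t ≤ B * s := by
  intro t ht
  have hc₁ : ContinuousOn ζ₁ (Set.Icc (2 * s) T) := fun t ht => (hz₁ t ht).continuousWithinAt
  have hc₂ : ContinuousOn ζ₂ (Set.Icc (2 * s) T) := fun t ht => (hz₂ t ht).continuousWithinAt
  have h2 : 2 * s ∈ Set.Icc (2 * s) T := ⟨le_rfl, ht.1.trans ht.2⟩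
  refine image_le_of_deriv_right_lt_deriv_boundary' (f := fun t => ζ₁ t - ζ₂ t)
      (f' := fun t => (1 + K₁ t * (ζ₁ t) ^ 2) - (1 + K₂ t * (ζ₂ t) ^ 2)) (a := 2 * s) (b := T)
      (B := fun t => B * s) (B' := fun _ => 0) (hc₁.sub hc₂)
      (fun x hx => (ric_right hx (hz₁ x ⟨hx.1, hx.2.le⟩)).sub
        (ric_right hx (hz₂ x ⟨hx.1, hx.2.le⟩))) ?_ (by fun_prop)
      (fun x hx => (hasDerivAt_const x _).hasDerivWithinAt) ?_ ht
  · have := (hb₁ _ h2).2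
    have := (hb₂ _ h2).1
    have : 0 < c * (2 * s - s) := by apply mul_pos hcpos; linarith
    show ζ₁ (2 * s) - ζ₂ (2 * s) ≤ B * s
    nlinarith
  · intro x hx he
    have he' : ζ₁ x - ζ₂ x = B * s := he
    have hx' : x ∈ Set.Icc (2 * s) T := ⟨hx.1, hx.2.le⟩
    have hx1 := hx.1
    have hx0 : 0 < x := by linarith
    obtain ⟨h1, h1'⟩ := hb₁ x hx'
    obtain ⟨h3, h3'⟩ := hb₂ x hx'
    have hk := hK x ⟨hx0, hx.2.le⟩
    have hkk := hKK x ⟨hx0, hx.2.le⟩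
    have hBs : 0 < B * s := by nlinarith
    have hsum : c * x ≤ ζ₁ x + ζ₂ x := by nlinarith
    have hz2 : 0 ≤ ζ₂ x := le_trans (by apply mul_nonneg hcpos.le; linarith) h3
    show (1 + K₁ x * (ζ₁ x) ^ 2) - (1 + K₂ x * (ζ₂ x) ^ 2) < 0
    have e : (1 + K₁ x * (ζ₁ x) ^ 2) - (1 + K₂ x * (ζ₂ x) ^ 2)
        = K₁ x * ((ζ₁ x + ζ₂ x) * (B * s)) + (K₁ x - K₂ x) * (ζ₂ x) ^ 2 := by
      rw [← he']; ring
    rw [e]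
    have t1 : K₁ x * ((ζ₁ x + ζ₂ x) * (B * s)) ≤ -q ^ 2 / x ^ 2 * (c * x * (B * s)) := by
      have hq : -q ^ 2 / x ^ 2 ≤ 0 := by
        rw [neg_div]; exact neg_nonpos.2 (by positivity)
      have hcx : 0 < c * x := by positivity
      calc _ ≤ -q ^ 2 / x ^ 2 * ((ζ₁ x + ζ₂ x) * (B * s)) :=
            mul_le_mul_of_nonneg_right hk (mul_nonneg (by linarith) hBs.le)
        _ ≤ _ := mul_le_mul_of_nonpos_left (mul_le_mul_of_nonneg_right hsum hBs.le) hq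
    have t2 : (K₁ x - K₂ x) * (ζ₂ x) ^ 2 ≤ N * s / x ^ 3 * x ^ 2 := by
      calc _ ≤ N * s / x ^ 3 * (ζ₂ x) ^ 2 := mul_le_mul_of_nonneg_right hkk (sq_nonneg _)
        _ ≤ _ := by gcongr
    have t3 : -q ^ 2 / x ^ 2 * (c * x * (B * s)) + N * s / x ^ 3 * x ^ 2
        = (N - q ^ 2 * c * B) * (s / x) := by
      field_simp
      ring
    have t4 : (N - q ^ 2 * c * B) * (s / x) < 0 :=
      mul_neg_of_neg_of_pos (by linarith) (by positivity)
    linarith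


/-- **Stability of Riccati solutions under perturbation of the coefficient.**
Let `r > 1`, `ε ∈ (0,1)`, `N > 0`.  Then there exists `C > 0` such that:
for all `0 < s' ≤ s < T` with `(1 + 2/ε)s ≤ T`, all continuous
`K₁, K₂ : (0,T] → ℝ` with `-r²/t² ≤ Kᵢ(t) ≤ -(r-1)²/t²` and
`|K₁(t) - K₂(t)| ≤ N·s/t³` on `(0,T]`, and all differentiable `ζ₁ : [s,T] → ℝ`,
`ζ₂ : [s',T] → ℝ` with `ζᵢ' = 1 + Kᵢζᵢ²`, `ζ₁(s) = 0`, `ζ₂(s') = 0`, one has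
`|ζ₁(t) - ζ₂(t)| ≤ C·s` for all `t ∈ [(1 + 2/ε)s, T]`. -/
theorem riccati_perturbation_stability
    (r ε N : ℝ) (hr : 1 < r) (hε : ε ∈ Set.Ioo (0:ℝ) 1) (hN : 0 < N) :
    ∃ C > 0, ∀ (s' s T : ℝ) (K₁ K₂ ζ₁ ζ₂ : ℝ → ℝ),
      0 < s' → s' ≤ s → s < T → (1 + 2 / ε) * s ≤ T →
      ContinuousOn K₁ (Set.Ioc 0 T) →
      ContinuousOn K₂ (Set.Ioc 0 T) →
      (∀ t ∈ Set.Ioc (0:ℝ) T,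
        -r ^ 2 / t ^ 2 ≤ K₁ t ∧ K₁ t ≤ -(r - 1) ^ 2 / t ^ 2) →
      (∀ t ∈ Set.Ioc (0:ℝ) T,
        -r ^ 2 / t ^ 2 ≤ K₂ t ∧ K₂ t ≤ -(r - 1) ^ 2 / t ^ 2) →
      (∀ t ∈ Set.Ioc (0:ℝ) T, |K₁ t - K₂ t| ≤ N * s / t ^ 3) →
      (∀ t ∈ Set.Icc s T,
        HasDerivWithinAt ζ₁ (1 + K₁ t * (ζ₁ t) ^ 2) (Set.Icc s T) t) →
      (∀ t ∈ Set.Icc s' T,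
        HasDerivWithinAt ζ₂ (1 + K₂ t * (ζ₂ t) ^ 2) (Set.Icc s' T) t) →
      ζ₁ s = 0 → ζ₂ s' = 0 →
      ∀ t ∈ Set.Icc ((1 + 2 / ε) * s) T, |ζ₁ t - ζ₂ t| ≤ C * s := by

  have hq : 0 < r - 1 := by linarith
  have hcpos : 0 < 1 / (2 + r ^ 2) := by positivity
  obtain ⟨c, hc⟩ : ∃ c, c = 1 / (2 + r ^ 2) := ⟨_, rfl⟩
  rw [← hc] at hcpos
  have ha : 0 < (r - 1) ^ 2 * c := by positivity
  refine ⟨2 + N / ((r - 1) ^ 2 * c), by positivity, ?_⟩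
  intro s' s T K₁ K₂ ζ₁ ζ₂ hs' hss hsT _ _ _ hK₁ hK₂ hKK hz₁ hz₂ h₁ h₂ t ht
  have hs : 0 < s := hs'.trans_le hss
  have hb₁ := ric_bounds r s T K₁ ζ₁ hs hK₁ hz₁ h₁
  have hb₂ := ric_bounds r s' T K₂ ζ₂ hs' hK₂ hz₂ h₂
  rw [← hc] at hb₁ hb₂
  have sub₁ : Set.Icc (2 * s) T ⊆ Set.Icc s T := Set.Icc_subset_Icc_left (by linarith)
  have sub₂ : Set.Icc (2 * s) T ⊆ Set.Icc s' T := Set.Icc_subset_Icc_left (by linarith)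
  have hB : 2 ≤ 2 + N / ((r - 1) ^ 2 * c) := by
    have : 0 < N / ((r - 1) ^ 2 * c) := by positivity
    linarith
  have hBN : N < (r - 1) ^ 2 * c * (2 + N / ((r - 1) ^ 2 * c)) := by
    rw [mul_add, mul_div_cancel₀ _ ha.ne']
    linarith
  have ht2 : t ∈ Set.Icc (2 * s) T := by
    refine ⟨le_trans ?_ ht.1, ht.2⟩
    have : 1 ≤ 2 / ε := by rw [le_div_iff₀ hε.1]; linarith [hε.2]
    nlinarith
  have hz₁' := fun t ht => (hz₁ t (sub₁ ht)).mono sub₁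
  have hz₂' := fun t ht => (hz₂ t (sub₂ ht)).mono sub₂
  have hb₁' := fun t ht => hb₁ t (sub₁ ht)
  have hb₂' : ∀ t ∈ Set.Icc (2 * s) T, c * (t - s) ≤ ζ₂ t ∧ ζ₂ t ≤ t := fun t ht =>
    ⟨le_trans (by gcongr) (hb₂ t (sub₂ ht)).1, (hb₂ t (sub₂ ht)).2⟩
  have d₁ := ric_diff (r - 1) c N _ s T K₁ K₂ ζ₁ ζ₂ hs hcpos hB hBN
    (fun t ht => (hK₁ t ht).2) (fun t ht => (abs_le.1 (hKK t ht)).2) hN hz₁' hz₂' hb₁' hb₂' t ht2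
  have d₂ := ric_diff (r - 1) c N _ s T K₂ K₁ ζ₂ ζ₁ hs hcpos hB hBN
    (fun t ht => (hK₂ t ht).2) (fun t ht => by linarith [(abs_le.1 (hKK t ht)).1])
    hN hz₂' hz₁' hb₂' hb₁' t ht2
  exact abs_le.2 ⟨by linarith, d₁⟩
end

section
/- Bound for the variational equation of the Riccati equation: Let r > 1, N > 0, and 0 < s < T. Let K : [s,T] → ℝ be continuous with −r²/t² ≤ K(t) ≤ −(r−1)²/t² for all t ∈ [s,T]. Let j : [s,T] → ℝ solve j'' = −K·j with j(s) = 0 and j'(s) = 1 (so j > 0 and j' > 0 on (s,T]), and set u = j/j' on (s,T], extended by u(s) = 0. Let G : [s,T] → ℝ be continuous with |G(t)| ≤ N/t³ for all t, and let w : [s,T] → ℝ be differentiable with w'(t) = j(t)·G(t)·u(t)² + 2u(t)K(t)w(t) for all t ∈ [s,T] and w(s) = 0. Then |w(t)| ≤ N·j(t) for all t ∈ [s,T]. -/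
theorem ge_left_of_deriv_nonneg (s T : ℝ) (f f' : ℝ → ℝ)
    (hf : ∀ t ∈ Set.Icc s T, HasDerivWithinAt f (f' t) (Set.Icc s T) t)
    (h0 : ∀ t ∈ Set.Icc s T, 0 ≤ f' t) : ∀ t ∈ Set.Icc s T, f s ≤ f t := by
  have hm : MonotoneOn f (Set.Icc s T) := by
    apply monotoneOn_of_hasDerivWithinAt_nonneg (f' := f') (convex_Icc s T)
    · exact fun t ht => (hf t ht).continuousWithinAt
    · exact fun t ht => (hf t (interior_subset ht)).mono interior_subset
    · exact fun t ht => h0 t (interior_subset ht)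
  intro t ht
  exact hm ⟨le_refl _, ht.1.trans ht.2⟩ ht ht.1

/-- **Bound for the variational equation of the Riccati equation.**
Let `r > 1`, `N > 0`, `0 < s < T`.  Let `K : [s,T] → ℝ` be continuous with
`-r²/t² ≤ K(t) ≤ -(r-1)²/t²`.  Let `j` solve `j'' = -K·j` on `[s,T]` with
`j(s) = 0`, `j'(s) = 1` (so `j > 0` and `j' > 0` on `(s,T]`), and set
`u = j/j'` (note `u(s) = 0` automatically).  Let `G : [s,T] → ℝ` be continuous
with `|G(t)| ≤ N/t³`, and let `w` be differentiable with
`w' = j·G·u² + 2uKw` on `[s,T]` and `w(s) = 0`.  Then `|w(t)| ≤ N·j(t)` on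
`[s,T]`. -/
theorem riccati_variational_bound
    (r N s T : ℝ) (hr : 1 < r) (hN : 0 < N) (hs : 0 < s) (hsT : s < T)
    (K : ℝ → ℝ) (hK : ContinuousOn K (Set.Icc s T))
    (hKb : ∀ t ∈ Set.Icc s T,
      -r ^ 2 / t ^ 2 ≤ K t ∧ K t ≤ -(r - 1) ^ 2 / t ^ 2)
    (j j' : ℝ → ℝ)
    (hj : ∀ t ∈ Set.Icc s T, HasDerivWithinAt j (j' t) (Set.Icc s T) t)
    (hj' : ∀ t ∈ Set.Icc s T,
      HasDerivWithinAt j' (-(K t) * j t) (Set.Icc s T) t)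
    (hj0 : j s = 0) (hj'0 : j' s = 1)
    (G : ℝ → ℝ) (hG : ContinuousOn G (Set.Icc s T))
    (hGb : ∀ t ∈ Set.Icc s T, |G t| ≤ N / t ^ 3)
    (w : ℝ → ℝ)
    (hw : ∀ t ∈ Set.Icc s T,
      HasDerivWithinAt w
        (j t * G t * (j t / j' t) ^ 2 + 2 * (j t / j' t) * K t * w t)
        (Set.Icc s T) t)
    (hw0 : w s = 0) :
    ∀ t ∈ Set.Icc s T, |w t| ≤ N * j t := by
  have hK0 : ∀ t ∈ Set.Icc s T, K t ≤ 0 := by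
    intro t ht
    refine (hKb t ht).2.trans ?_
    rw [neg_div]
    have : 0 ≤ (r - 1) ^ 2 / t ^ 2 := by positivity
    linarith
  have hjj : ∀ t ∈ Set.Icc s T, 0 ≤ j t * j' t := by
    have := ge_left_of_deriv_nonneg s T _ _ (fun t ht => (hj t ht).mul (hj' t ht)) (by
      intro t ht
      have := mul_nonneg (neg_nonneg.2 (hK0 t ht)) (sq_nonneg (j t))
      nlinarith [sq_nonneg (j' t)])
    intro t ht
    simpa [hj0] using this t ht
  have hsq : ∀ t ∈ Set.Icc s T, 1 ≤ j' t * j' t := by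
    have := ge_left_of_deriv_nonneg s T _ _ (fun t ht => (hj' t ht).mul (hj' t ht)) (by
      intro t ht
      have := mul_nonneg (neg_nonneg.2 (hK0 t ht)) (hjj t ht)
      nlinarith)
    intro t ht
    simpa [hj'0] using this t ht
  have hpos : ∀ t ∈ Set.Icc s T, 0 < j' t := by
    intro t ht
    by_contra hneg
    push Not at hneg
    have hc : ContinuousOn j' (Set.Icc s t) := fun x hx =>
      ((hj' x ⟨hx.1, hx.2.trans ht.2⟩).continuousWithinAt).mono
        (Set.Icc_subset_Icc_right ht.2)
    obtain ⟨x, hx, hx0⟩ := intermediate_value_Icc' ht.1 hc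
      (show (0 : ℝ) ∈ Set.Icc (j' t) (j' s) from ⟨hneg, by rw [hj'0]; norm_num⟩)
    have := hsq x ⟨hx.1, hx.2.trans ht.2⟩
    rw [hx0] at this
    norm_num at this
  have hjn : ∀ t ∈ Set.Icc s T, 0 ≤ j t := by
    have := ge_left_of_deriv_nonneg s T _ _ hj (fun t ht => (hpos t ht).le)
    simpa only [hj0] using this
  have htj : ∀ t ∈ Set.Icc s T, j t ≤ t * j' t := by
    have := ge_left_of_deriv_nonneg s T _ _
      (fun t ht => (((hasDerivWithinAt_id t _).mul (hj' t ht)).sub (hj t ht))) (by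
      intro t ht
      have := mul_nonneg (mul_nonneg (hs.le.trans ht.1) (neg_nonneg.2 (hK0 t ht))) (hjn t ht)
      simp only [id]
      nlinarith)
    intro t ht
    have := this t ht
    simp [hj0, hj'0] at this
    linarith
  -- the bound on the inhomogeneous term
  have hGj : ∀ t ∈ Set.Icc s T, |j t ^ 3 * G t| ≤ N * j' t ^ 3 := by
    intro t ht
    have ht0 : 0 < t := hs.trans_le ht.1
    rw [abs_mul, abs_of_nonneg (pow_nonneg (hjn t ht) 3)]
    calc j t ^ 3 * |G t| ≤ (t * j' t) ^ 3 * (N / t ^ 3) := by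
          have h1 := pow_le_pow_left₀ (hjn t ht) (htj t ht) 3
          have h2 : 0 ≤ (t * j' t) ^ 3 := (pow_nonneg (hjn t ht) 3).trans h1
          exact mul_le_mul h1 (hGb t ht) (abs_nonneg _) h2
      _ = N * j' t ^ 3 := by field_simp
  have hv : ∀ t ∈ Set.Icc s T,
      HasDerivWithinAt (fun t => j' t ^ 2 * w t) (j t ^ 3 * G t) (Set.Icc s T) t := by
    intro t ht
    have hne := (hpos t ht).ne'
    refine (((hj' t ht).pow 2).mul (hw t ht)).congr_deriv ?_
    simp only [Pi.pow_apply]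
    field_simp
    push_cast
    ring
  have hb : ∀ t ∈ Set.Icc s T, HasDerivWithinAt (fun t => N * (j' t ^ 2 * j t))
      (N * (j' t ^ 3 + 2 * j' t * (-K t) * j t ^ 2)) (Set.Icc s T) t := by
    intro t ht
    refine ((((hj' t ht).pow 2).mul (hj t ht)).const_mul N).congr_deriv ?_
    simp only [Pi.pow_apply]
    push_cast
    ring
  have hd : ∀ t ∈ Set.Icc s T,
      N * j' t ^ 3 ≤ N * (j' t ^ 3 + 2 * j' t * (-K t) * j t ^ 2) := by
    intro t ht
    have h1 := mul_nonneg (mul_nonneg (hpos t ht).le (neg_nonneg.2 (hK0 t ht)))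
      (sq_nonneg (j t))
    apply mul_le_mul_of_nonneg_left _ hN.le
    linarith
  have hp := ge_left_of_deriv_nonneg s T _ _ (fun t ht => (hb t ht).add (hv t ht)) (by
    intro t ht
    linarith [hd t ht, (abs_le.1 (hGj t ht)).1])
  have hm := ge_left_of_deriv_nonneg s T _ _ (fun t ht => (hb t ht).sub (hv t ht)) (by
    intro t ht
    linarith [hd t ht, (abs_le.1 (hGj t ht)).2])
  intro t ht
  have h1 := hp t ht
  have h2 := hm t ht
  simp only [Pi.add_apply, Pi.sub_apply, hj0, hw0, mul_zero, add_zero, sub_zero] at h1 h2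
  have h3 : 0 < j' t ^ 2 := pow_pos (hpos t ht) 2
  rw [abs_le]
  constructor
  · refine le_of_mul_le_mul_left ?_ h3
    linarith
  · refine le_of_mul_le_mul_left ?_ h3
    linarith
end

section
/- Ratio estimate for Jacobi field derivatives: Let r > 0, μ ∈ (0,1), and N > 0. Then there exists C > 0 such that the following holds for every δ₀ > 0 and every s ∈ (0,δ₀]. Let K₁, K₂ : (0,δ₀] → ℝ be continuous with |Kᵢ(x)| ≤ r²/x² and |K₁(x) − K₂(x)| ≤ N·s/x³ for all x ∈ (0,δ₀], and let ζ₁, ζ₂ : (0,δ₀] → ℝ be continuous with 0 ≤ ζᵢ(x) ≤ x/μ and |ζ₁(x) − ζ₂(x)| ≤ N·s for all x ∈ (0,δ₀]. For i = 1,2 define jᵢ'(t) = exp(∫ₜ^{δ₀} Kᵢ(x)ζᵢ(x) dx) for t ∈ (0,δ₀]. Then |log j₁'(t) − log j₂'(t)| ≤ C·s/t for all t ∈ [s, δ₀]; in particular j₁'(t)/j₂'(t) = 1 + O(s/t). -/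
/-- **Ratio estimate for Jacobi field derivatives.**
Let `r > 0`, `μ ∈ (0,1)`, `N > 0`.  There is `C > 0` such that for every
`δ₀ > 0` and every `s ∈ (0,δ₀]`: for all continuous `K₁, K₂ : (0,δ₀] → ℝ`
with `|Kᵢ(x)| ≤ r²/x²` and `|K₁(x) - K₂(x)| ≤ N·s/x³`, and all continuous
`ζ₁, ζ₂ : (0,δ₀] → ℝ` with `0 ≤ ζᵢ(x) ≤ x/μ` and `|ζ₁(x) - ζ₂(x)| ≤ N·s`,
defining `jᵢ'(t) = exp(∫ₜ^{δ₀} Kᵢ(x)ζᵢ(x) dx)`, one has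
`|log j₁'(t) - log j₂'(t)| ≤ C·s/t` for all `t ∈ [s,δ₀]`. -/
theorem jacobi_derivative_ratio
    (r μ N : ℝ) (hr : 0 < r) (hμ : μ ∈ Set.Ioo (0:ℝ) 1) (hN : 0 < N) :
    ∃ C > 0, ∀ δ₀ : ℝ, 0 < δ₀ → ∀ s ∈ Set.Ioc (0:ℝ) δ₀,
      ∀ K₁ K₂ ζ₁ ζ₂ : ℝ → ℝ,
      ContinuousOn K₁ (Set.Ioc 0 δ₀) →
      ContinuousOn K₂ (Set.Ioc 0 δ₀) →
      (∀ x ∈ Set.Ioc (0:ℝ) δ₀, |K₁ x| ≤ r ^ 2 / x ^ 2) →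
      (∀ x ∈ Set.Ioc (0:ℝ) δ₀, |K₂ x| ≤ r ^ 2 / x ^ 2) →
      (∀ x ∈ Set.Ioc (0:ℝ) δ₀, |K₁ x - K₂ x| ≤ N * s / x ^ 3) →
      ContinuousOn ζ₁ (Set.Ioc 0 δ₀) →
      ContinuousOn ζ₂ (Set.Ioc 0 δ₀) →
      (∀ x ∈ Set.Ioc (0:ℝ) δ₀, 0 ≤ ζ₁ x ∧ ζ₁ x ≤ x / μ) →
      (∀ x ∈ Set.Ioc (0:ℝ) δ₀, 0 ≤ ζ₂ x ∧ ζ₂ x ≤ x / μ) →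
      (∀ x ∈ Set.Ioc (0:ℝ) δ₀, |ζ₁ x - ζ₂ x| ≤ N * s) →
      ∀ j₁' j₂' : ℝ → ℝ,
      (∀ t ∈ Set.Ioc (0:ℝ) δ₀,
        j₁' t = Real.exp (∫ x in t..δ₀, K₁ x * ζ₁ x)) →
      (∀ t ∈ Set.Ioc (0:ℝ) δ₀,
        j₂' t = Real.exp (∫ x in t..δ₀, K₂ x * ζ₂ x)) →
      ∀ t ∈ Set.Icc s δ₀,
        |Real.log (j₁' t) - Real.log (j₂' t)| ≤ C * s / t := by
  obtain ⟨hμ0, hμ1⟩ := hμ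
  refine ⟨N / μ + r ^ 2 * N, by positivity, ?_⟩
  intro δ₀ hδ s hs K₁ K₂ ζ₁ ζ₂ cK₁ cK₂ bK₁ bK₂ dK cζ₁ cζ₂ bζ₁ bζ₂ dζ j₁ j₂ hj₁ hj₂ t ht
  have hs0 : 0 < s := hs.1
  have ht0 : 0 < t := lt_of_lt_of_le hs0 ht.1
  have htδ : t ≤ δ₀ := ht.2
  have hsub : Set.uIcc t δ₀ ⊆ Set.Ioc 0 δ₀ := by
    rw [Set.uIcc_of_le htδ]
    intro x hx
    exact ⟨lt_of_lt_of_le ht0 hx.1, hx.2⟩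
  have i₁ : IntervalIntegrable (fun x => K₁ x * ζ₁ x) MeasureTheory.volume t δ₀ :=
    ((cK₁.mul cζ₁).mono hsub).intervalIntegrable
  have i₂ : IntervalIntegrable (fun x => K₂ x * ζ₂ x) MeasureTheory.volume t δ₀ :=
    ((cK₂.mul cζ₂).mono hsub).intervalIntegrable
  rw [hj₁ t ⟨ht0, htδ⟩, hj₂ t ⟨ht0, htδ⟩, Real.log_exp, Real.log_exp,
    ← intervalIntegral.integral_sub i₁ i₂]
  set A : ℝ := (N / μ + r ^ 2 * N) * s with hA
  have hA0 : 0 < A := by positivity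
  have cg : ContinuousOn (fun x : ℝ => -A * -(x ^ 2)⁻¹) (Set.uIcc t δ₀) := by
    have : ∀ x ∈ Set.uIcc t δ₀, x ^ 2 ≠ 0 := fun x hx => pow_ne_zero _ (hsub hx).1.ne'
    exact continuousOn_const.mul (((continuousOn_id.pow 2).inv₀ this).neg)
  have ig := cg.intervalIntegrable (μ := MeasureTheory.volume)
  have hint : ∫ x in t..δ₀, -A * -(x ^ 2)⁻¹ = -A * δ₀⁻¹ - -A * t⁻¹ :=
    intervalIntegral.integral_eq_sub_of_hasDerivAt (f := fun x => -A * x⁻¹)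
      (fun x hx => (hasDerivAt_inv (hsub hx).1.ne').const_mul (-A)) ig
  have hb : ∀ x ∈ Set.Ioc t δ₀, ‖K₁ x * ζ₁ x - K₂ x * ζ₂ x‖ ≤ -A * -(x ^ 2)⁻¹ := by
    intro x hx
    have hx0 : 0 < x := lt_trans ht0 hx.1
    have hxm : x ∈ Set.Ioc 0 δ₀ := ⟨hx0, hx.2⟩
    have e : K₁ x * ζ₁ x - K₂ x * ζ₂ x = (K₁ x - K₂ x) * ζ₁ x + K₂ x * (ζ₁ x - ζ₂ x) := by
      ring
    rw [Real.norm_eq_abs, e]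
    calc _ ≤ |K₁ x - K₂ x| * |ζ₁ x| + |K₂ x| * |ζ₁ x - ζ₂ x| := by
          rw [← abs_mul, ← abs_mul]; exact abs_add_le _ _
      _ ≤ (N * s / x ^ 3) * (x / μ) + (r ^ 2 / x ^ 2) * (N * s) := by
          rw [abs_of_nonneg (bζ₁ x hxm).1]
          exact add_le_add
            (mul_le_mul (dK x hxm) (bζ₁ x hxm).2 (bζ₁ x hxm).1 (by positivity))
            (mul_le_mul (bK₂ x hxm) (dζ x hxm) (abs_nonneg _) (by positivity))
      _ = -A * -(x ^ 2)⁻¹ := by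
          rw [hA]; field_simp
  have h := intervalIntegral.norm_integral_le_of_norm_le htδ
    (Filter.Eventually.of_forall hb) ig
  rw [hint, Real.norm_eq_abs] at h
  refine h.trans ?_
  have : 0 < A * δ₀⁻¹ := by positivity
  rw [div_eq_mul_inv]
  linarith
end

section
/- Invariance of the upper edge of the unstable Riccati cone near the cusp: Let r > 2 and ε ∈ (0, (r−2)/2), and let C₀ > 0. Then there exists δ₀ > 0 such that the following holds. Let T > 0, let δ : [0,T] → (0,δ₀] be C¹ with |δ'(t)| ≤ 1 for all t, and let K : [0,T] → ℝ be continuous with |K(t) + r(r−1)/δ(t)²| ≤ C₀/δ(t) for all t ∈ [0,T]. If ζ : [0,T] → ℝ is differentiable with ζ'(t) = 1 + K(t)ζ(t)² for all t and ζ(0) ≤ δ(0)/(r−1−ε), then ζ(t) ≤ δ(t)/(r−1−ε) for all t ∈ [0,T]. -/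
/-- **Invariance of the upper edge of the unstable Riccati cone near the cusp.**
Let `r > 2`, `ε ∈ (0, (r-2)/2)`, `C₀ > 0`.  There is `δ₀ > 0` such that for
every `T > 0`, every `C¹` function `δ : [0,T] → (0,δ₀]` with `|δ'| ≤ 1`, and
every continuous `K : [0,T] → ℝ` with `|K(t) + r(r-1)/δ(t)²| ≤ C₀/δ(t)`:
if `ζ` is differentiable with `ζ' = 1 + Kζ²` on `[0,T]` and
`ζ(0) ≤ δ(0)/(r-1-ε)`, then `ζ(t) ≤ δ(t)/(r-1-ε)` for all `t ∈ [0,T]`. -/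
theorem cone_upper_edge_invariance
    (r ε C₀ : ℝ) (hr : 2 < r) (hε : ε ∈ Set.Ioo 0 ((r - 2) / 2))
    (hC₀ : 0 < C₀) :
    ∃ δ₀ > 0, ∀ T : ℝ, 0 < T →
      ∀ δ δ' K ζ : ℝ → ℝ,
      (∀ t ∈ Set.Icc (0:ℝ) T, HasDerivWithinAt δ (δ' t) (Set.Icc 0 T) t) →
      ContinuousOn δ' (Set.Icc 0 T) →
      (∀ t ∈ Set.Icc (0:ℝ) T, 0 < δ t ∧ δ t ≤ δ₀) →
      (∀ t ∈ Set.Icc (0:ℝ) T, |δ' t| ≤ 1) →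
      ContinuousOn K (Set.Icc 0 T) →
      (∀ t ∈ Set.Icc (0:ℝ) T,
        |K t + r * (r - 1) / (δ t) ^ 2| ≤ C₀ / δ t) →
      (∀ t ∈ Set.Icc (0:ℝ) T,
        HasDerivWithinAt ζ (1 + K t * (ζ t) ^ 2) (Set.Icc 0 T) t) →
      ζ 0 ≤ δ 0 / (r - 1 - ε) →
      ∀ t ∈ Set.Icc (0:ℝ) T, ζ t ≤ δ t / (r - 1 - ε) := by
  obtain ⟨he0, he1⟩ := hε
  have ha : 0 < r - 1 - ε := by linarith
  have hg : 0 < ε * (2 * r - 1 - ε) := mul_pos he0 (by linarith)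
  refine ⟨ε * (2 * r - 1 - ε) / (2 * C₀), by positivity, ?_⟩
  intro T hT δ δ' K ζ hδ _ hδ0 hδ1 _ hK hζ h0 t ht
  have hnhds : ∀ x ∈ Set.Ico (0:ℝ) T, Set.Icc 0 T ∈ nhdsWithin x (Set.Ici x) := by
    intro x hx
    exact Filter.mem_of_superset (Icc_mem_nhdsGE hx.2) (Set.Icc_subset_Icc_left hx.1)
  refine image_le_of_deriv_right_lt_deriv_boundary' (f := ζ)
    (f' := fun x => 1 + K x * (ζ x) ^ 2) (B := fun x => δ x / (r - 1 - ε))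
    (B' := fun x => δ' x / (r - 1 - ε))
    (fun x hx => (hζ x hx).continuousWithinAt)
    (fun x hx => (hζ x (Set.Ico_subset_Icc_self hx)).mono_of_mem_nhdsWithin (hnhds x hx))
    h0
    (fun x hx => ((hδ x hx).div_const _).continuousWithinAt)
    (fun x hx => ((hδ x (Set.Ico_subset_Icc_self hx)).div_const _).mono_of_mem_nhdsWithin
      (hnhds x hx)) ?_ ht
  intro x hx hxe
  have hx' := Set.Ico_subset_Icc_self hx
  obtain ⟨hd, hd0⟩ := hδ0 x hx'
  have h1 := (abs_le.mp (hδ1 x hx')).1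
  have h2 := (abs_le.mp (hK x hx')).2
  have h3 : K x * δ x ^ 2 + r * (r - 1) ≤ C₀ * δ x := by
    have := mul_le_mul_of_nonneg_right h2 (sq_nonneg (δ x))
    have e1 : (K x + r * (r - 1) / δ x ^ 2) * δ x ^ 2 = K x * δ x ^ 2 + r * (r - 1) := by
      field_simp
    have e2 : C₀ / δ x * δ x ^ 2 = C₀ * δ x := by
      field_simp
    rwa [e1, e2] at this
  rw [le_div_iff₀ (by positivity)] at hd0
  rw [hxe, div_pow]
  have e3 : 1 + K x * (δ x ^ 2 / (r - 1 - ε) ^ 2)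
      = ((r - 1 - ε) ^ 2 + K x * δ x ^ 2) / (r - 1 - ε) ^ 2 := by
    field_simp
  have e4 : δ' x / (r - 1 - ε) = (δ' x * (r - 1 - ε)) / (r - 1 - ε) ^ 2 := by
    field_simp
  rw [e3, e4]
  apply div_lt_div_of_pos_right _ (by positivity)
  have h5 := mul_le_mul_of_nonneg_right h1 ha.le
  nlinarith
end

section
/- Invariance of the lower edge of the unstable Riccati cone near the cusp: Let r > 2 and ε ∈ (0, (r−2)/2), and let C₀ > 0. Then there exists δ₀ > 0 such that the following holds. Let T > 0, let δ : [0,T] → (0,δ₀] be C¹ with |δ'(t)| ≤ 1 for all t, and let K : [0,T] → ℝ be continuous with |K(t) + r(r−1)/δ(t)²| ≤ C₀/δ(t) for all t ∈ [0,T]. If ζ : [0,T] → ℝ is differentiable with ζ'(t) = 1 + K(t)ζ(t)² for all t and ζ(0) ≥ δ(0)/(r+ε), then ζ(t) ≥ δ(t)/(r+ε) for all t ∈ [0,T]. -/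
/-- **Invariance of the lower edge of the unstable Riccati cone near the cusp.**
Let `r > 2`, `ε ∈ (0, (r-2)/2)`, `C₀ > 0`.  There is `δ₀ > 0` such that for
every `T > 0`, every `C¹` function `δ : [0,T] → (0,δ₀]` with `|δ'| ≤ 1`, and
every continuous `K : [0,T] → ℝ` with `|K(t) + r(r-1)/δ(t)²| ≤ C₀/δ(t)`:
if `ζ` is differentiable with `ζ' = 1 + Kζ²` on `[0,T]` and
`ζ(0) ≥ δ(0)/(r+ε)`, then `ζ(t) ≥ δ(t)/(r+ε)` for all `t ∈ [0,T]`. -/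
theorem cone_lower_edge_invariance
    (r ε C₀ : ℝ) (hr : 2 < r) (hε : ε ∈ Set.Ioo 0 ((r - 2) / 2))
    (hC₀ : 0 < C₀) :
    ∃ δ₀ > 0, ∀ T : ℝ, 0 < T →
      ∀ δ δ' K ζ : ℝ → ℝ,
      (∀ t ∈ Set.Icc (0:ℝ) T, HasDerivWithinAt δ (δ' t) (Set.Icc 0 T) t) →
      ContinuousOn δ' (Set.Icc 0 T) →
      (∀ t ∈ Set.Icc (0:ℝ) T, 0 < δ t ∧ δ t ≤ δ₀) →
      (∀ t ∈ Set.Icc (0:ℝ) T, |δ' t| ≤ 1) →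
      ContinuousOn K (Set.Icc 0 T) →
      (∀ t ∈ Set.Icc (0:ℝ) T,
        |K t + r * (r - 1) / (δ t) ^ 2| ≤ C₀ / δ t) →
      (∀ t ∈ Set.Icc (0:ℝ) T,
        HasDerivWithinAt ζ (1 + K t * (ζ t) ^ 2) (Set.Icc 0 T) t) →
      δ 0 / (r + ε) ≤ ζ 0 →
      ∀ t ∈ Set.Icc (0:ℝ) T, δ t / (r + ε) ≤ ζ t := by
  obtain ⟨hε0, -⟩ := hε
  refine ⟨ε / C₀, by positivity, ?_⟩
  intro T hT δ δ' K ζ hδ _ hδ0 hδ1 _ hK hζ h0 t ht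
  have ha : 0 < r + ε := by linarith
  have key : ∀ x ∈ Set.Ico (0:ℝ) T, Set.Icc 0 T ∈ nhdsWithin x (Set.Ici x) := fun x hx =>
    Filter.mem_of_superset (Icc_mem_nhdsGE hx.2) (Set.Icc_subset_Icc_left hx.1)
  refine image_le_of_deriv_right_lt_deriv_boundary' (f := fun t => δ t / (r + ε))
    (f' := fun t => δ' t / (r + ε)) (B := ζ) (B' := fun t => 1 + K t * (ζ t) ^ 2)
    (a := 0) (b := T) ?_ ?_ h0 ?_ ?_ ?_ ht
  · exact fun x hx => ((hδ x hx).div_const _).continuousWithinAt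
  · intro x hx
    exact ((hδ x ⟨hx.1, hx.2.le⟩).div_const _).mono_of_mem_nhdsWithin (key x hx)
  · exact fun x hx => (hζ x hx).continuousWithinAt
  · intro x hx
    exact (hζ x ⟨hx.1, hx.2.le⟩).mono_of_mem_nhdsWithin (key x hx)
  · intro x hx he
    have hx' : x ∈ Set.Icc (0:ℝ) T := ⟨hx.1, hx.2.le⟩
    obtain ⟨hp, hle⟩ := hδ0 x hx'
    have h1 := (abs_le.mp (hδ1 x hx')).2
    have h2 := (abs_le.mp (hK x hx')).1
    have hd : C₀ * δ x ≤ ε := by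
      rw [le_div_iff₀ hC₀] at hle; linarith
    have h3 : -(r * (r - 1) + C₀ * δ x) ≤ K x * δ x ^ 2 := by
      have h4 : -(C₀ / δ x) - r * (r - 1) / δ x ^ 2 ≤ K x := by linarith
      have h5 := mul_le_mul_of_nonneg_right h4 (sq_nonneg (δ x))
      have h6 : (-(C₀ / δ x) - r * (r - 1) / δ x ^ 2) * δ x ^ 2
          = -(r * (r - 1) + C₀ * δ x) := by
        field_simp
        ring
      linarith
    show δ' x / (r + ε) < 1 + K x * (ζ x) ^ 2
    rw [← he]
    have h7 : 1 + K x * (δ x / (r + ε)) ^ 2 - δ' x / (r + ε)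
        = ((r + ε) ^ 2 + K x * δ x ^ 2 - δ' x * (r + ε)) / (r + ε) ^ 2 := by
      field_simp
    have h8 : 0 < (r + ε) ^ 2 + K x * δ x ^ 2 - δ' x * (r + ε) := by
      have h9 : δ' x * (r + ε) ≤ 1 * (r + ε) := mul_le_mul_of_nonneg_right h1 ha.le
      nlinarith [mul_pos hε0 hε0, mul_pos hε0 (sub_pos.2 hr)]
    have h10 := div_pos h8 (pow_pos ha 2)
    linarith
end

section
/- Invariance of the upper edge of the cone for the logarithmic-derivative Riccati equation: Let r > 1, ε > 0, and T > 0. Let δ̄ : [0,T] → (0,∞) be C¹ with |δ̄'(t)| ≤ 1 for all t, and let K : [0,T] → ℝ be continuous with −K(t) ≤ (r+ε)(r−1+ε)/δ̄(t)² for all t ∈ [0,T]. If u : [0,T] → ℝ is differentiable with u'(t) = −K(t) − u(t)² for all t and u(0) ≤ (r+ε)/δ̄(0), then u(t) ≤ (r+ε)/δ̄(t) for all t ∈ [0,T]. -/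
/-- **Invariance of the upper edge of the cone for the logarithmic-derivative
Riccati equation.**  Let `r > 1`, `ε > 0`, `T > 0`.  Let `δ̄ : [0,T] → (0,∞)`
be `C¹` with `|δ̄'| ≤ 1`, and let `K : [0,T] → ℝ` be continuous with
`-K(t) ≤ (r+ε)(r-1+ε)/δ̄(t)²` on `[0,T]`.  If `u` is differentiable with
`u' = -K - u²` on `[0,T]` and `u(0) ≤ (r+ε)/δ̄(0)`, then
`u(t) ≤ (r+ε)/δ̄(t)` for all `t ∈ [0,T]`. -/
theorem log_derivative_cone_upper_edge
    (r ε T : ℝ) (hr : 1 < r) (hε : 0 < ε) (hT : 0 < T)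
    (δ δ' K u : ℝ → ℝ)
    (hδ : ∀ t ∈ Set.Icc (0:ℝ) T, HasDerivWithinAt δ (δ' t) (Set.Icc 0 T) t)
    (hδ'cont : ContinuousOn δ' (Set.Icc 0 T))
    (hδpos : ∀ t ∈ Set.Icc (0:ℝ) T, 0 < δ t)
    (hδ'b : ∀ t ∈ Set.Icc (0:ℝ) T, |δ' t| ≤ 1)
    (hK : ContinuousOn K (Set.Icc 0 T))
    (hKb : ∀ t ∈ Set.Icc (0:ℝ) T,
      -K t ≤ (r + ε) * (r - 1 + ε) / (δ t) ^ 2)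
    (hu : ∀ t ∈ Set.Icc (0:ℝ) T,
      HasDerivWithinAt u (-K t - (u t) ^ 2) (Set.Icc 0 T) t)
    (hu0 : u 0 ≤ (r + ε) / δ 0) :
    ∀ t ∈ Set.Icc (0:ℝ) T, u t ≤ (r + ε) / δ t := by
  have hw : ∀ t ∈ Set.Icc (0:ℝ) T, HasDerivWithinAt (fun t => u t - (r + ε) / δ t)
      ((-K t - (u t) ^ 2) - (0 * δ t - (r + ε) * δ' t) / (δ t) ^ 2) (Set.Icc 0 T) t := by
    intro t ht
    exact (hu t ht).sub
      ((hasDerivWithinAt_const t (Set.Icc 0 T) (r + ε)).div (hδ t ht) (hδpos t ht).ne')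
  intro t ht
  refine le_of_forall_pos_le_add fun η hη => ?_
  have key := image_le_of_deriv_right_lt_deriv_boundary
    (f := fun t => u t - (r + ε) / δ t)
    (f' := fun t => (-K t - (u t) ^ 2) - (0 * δ t - (r + ε) * δ' t) / (δ t) ^ 2)
    (a := 0) (b := T) (B := fun _ => η) (B' := fun _ => 0)
    (fun t ht => (hw t ht).continuousWithinAt)
    (fun t ht => (hw t ⟨ht.1, ht.2.le⟩).mono_of_mem_nhdsWithin
      (Filter.mem_of_superset (Icc_mem_nhdsGE ht.2) (Set.Icc_subset_Icc_left ht.1)))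
    (by linarith) (fun x => hasDerivAt_const x η)
    (by
      intro x hx hxe
      have hx' : x ∈ Set.Icc (0:ℝ) T := ⟨hx.1, hx.2.le⟩
      have hd := hδpos x hx'
      have hb := (abs_le.1 (hδ'b x hx')).2
      have hk := hKb x hx'
      have hv : 0 < (r + ε) / δ x := by positivity
      have h1 : (r + ε) * δ' x / (δ x) ^ 2 ≤ (r + ε) * 1 / (δ x) ^ 2 := by gcongr
      have h2 : (r + ε) * (r - 1 + ε) / (δ x) ^ 2 + (r + ε) * 1 / (δ x) ^ 2
          = ((r + ε) / δ x) ^ 2 := by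
        field_simp
        ring
      have h3 : (0 * δ x - (r + ε) * δ' x) / (δ x) ^ 2
          = - ((r + ε) * δ' x / (δ x) ^ 2) := by ring
      rw [h3]
      have h4 : ((r + ε) / δ x) ^ 2 < (u x) ^ 2 := by
        apply pow_lt_pow_left₀ _ hv.le two_ne_zero
        linarith
      linarith)
  have := key ht
  linarith
end

section
/- Quasi-Clairaut relation (scalar form): Let r > 0, C₀ > 0, T > 0, and δ₀ ∈ (0, r/C₀]. Let δ, a, b : [0,T] → ℝ be C¹ and c : [0,T] → ℝ be continuous, satisfying for all t ∈ [0,T]: a(t)² + b(t)² = 1, b(t) > 0, 0 < δ(t) ≤ δ₀, δ'(t) = a(t), a'(t) = b(t)²c(t), b'(t) = −a(t)b(t)c(t), and |c(t) − r/δ(t)| ≤ C₀. Then for all t₁, t₂ ∈ [0,T]: exp(−2C₀δ₀)·δ(t₂)^r·b(t₂) ≤ δ(t₁)^r·b(t₁) ≤ exp(2C₀δ₀)·δ(t₂)^r·b(t₂). -/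
lemma qc_mono (T : ℝ) (H H' : ℝ → ℝ)
    (hH : ∀ t ∈ Set.Icc (0:ℝ) T, HasDerivWithinAt H (H' t) (Set.Icc 0 T) t)
    (s t : ℝ) (hs : 0 ≤ s) (hst : s ≤ t) (ht : t ≤ T)
    (hn : ∀ x ∈ Set.Icc s t, 0 ≤ H' x) : H s ≤ H t := by
  have hsub : Set.Icc s t ⊆ Set.Icc 0 T := Set.Icc_subset_Icc hs ht
  have hm : MonotoneOn H (Set.Icc s t) := by
    refine monotoneOn_of_hasDerivWithinAt_nonneg (f' := H') (convex_Icc s t) ?_ ?_ ?_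
    · intro x hx
      exact ((hH x (hsub hx)).mono hsub).continuousWithinAt
    · intro x hx
      exact (hH x (hsub (interior_subset hx))).mono (interior_subset.trans hsub)
    · intro x hx
      exact hn x (interior_subset hx)
  exact hm (Set.left_mem_Icc.2 hst) (Set.right_mem_Icc.2 hst) hst

/-- **Quasi-Clairaut relation (scalar form).**
Let `r > 0`, `C₀ > 0`, `T > 0`, `δ₀ ∈ (0, r/C₀]`.  Let `δ, a, b : [0,T] → ℝ`
be `C¹` and `c : [0,T] → ℝ` continuous, with `a² + b² = 1`, `b > 0`,
`0 < δ ≤ δ₀`, `δ' = a`, `a' = b²c`, `b' = -abc`, and `|c - r/δ| ≤ C₀` on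
`[0,T]`.  Then for all `t₁, t₂ ∈ [0,T]`,
`exp(-2C₀δ₀)·δ(t₂)^r·b(t₂) ≤ δ(t₁)^r·b(t₁) ≤ exp(2C₀δ₀)·δ(t₂)^r·b(t₂)`. -/
theorem quasi_clairaut
    (r C₀ T δ₀ : ℝ) (hr : 0 < r) (hC₀ : 0 < C₀) (hT : 0 < T)
    (hδ₀ : δ₀ ∈ Set.Ioc 0 (r / C₀))
    (δ a b c : ℝ → ℝ)
    (hδ : ∀ t ∈ Set.Icc (0:ℝ) T, HasDerivWithinAt δ (a t) (Set.Icc 0 T) t)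
    (ha : ∀ t ∈ Set.Icc (0:ℝ) T,
      HasDerivWithinAt a (b t ^ 2 * c t) (Set.Icc 0 T) t)
    (hb : ∀ t ∈ Set.Icc (0:ℝ) T,
      HasDerivWithinAt b (-(a t * b t * c t)) (Set.Icc 0 T) t)
    (hc : ContinuousOn c (Set.Icc 0 T))
    (hab : ∀ t ∈ Set.Icc (0:ℝ) T, a t ^ 2 + b t ^ 2 = 1)
    (hbpos : ∀ t ∈ Set.Icc (0:ℝ) T, 0 < b t)
    (hδb : ∀ t ∈ Set.Icc (0:ℝ) T, 0 < δ t ∧ δ t ≤ δ₀)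
    (hcb : ∀ t ∈ Set.Icc (0:ℝ) T, |c t - r / δ t| ≤ C₀) :
    ∀ t₁ ∈ Set.Icc (0:ℝ) T, ∀ t₂ ∈ Set.Icc (0:ℝ) T,
      Real.exp (-(2 * C₀ * δ₀)) * δ t₂ ^ r * b t₂ ≤ δ t₁ ^ r * b t₁ ∧
      δ t₁ ^ r * b t₁ ≤ Real.exp (2 * C₀ * δ₀) * δ t₂ ^ r * b t₂ := by
  have hcn : ∀ t ∈ Set.Icc (0:ℝ) T, 0 ≤ c t := by
    intro t ht
    obtain ⟨h1, h2⟩ := hδb t ht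
    have h3 : C₀ * δ₀ ≤ r := by
      have := (le_div_iff₀ hC₀).1 hδ₀.2
      linarith
    have h4 : C₀ ≤ r / δ t := by
      rw [le_div_iff₀ h1]
      nlinarith
    have := (abs_le.1 (hcb t ht)).1
    linarith
  have hamono : ∀ s t, 0 ≤ s → s ≤ t → t ≤ T → a s ≤ a t := by
    intro s t hs hst ht
    refine qc_mono T a _ ha s t hs hst ht ?_
    intro x hx
    exact mul_nonneg (sq_nonneg _) (hcn x ⟨hs.trans hx.1, hx.2.trans ht⟩)
  obtain ⟨F, hFd⟩ : ∃ F : ℝ → ℝ, F = fun t => r * Real.log (δ t) + Real.log (b t) := ⟨_, rfl⟩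
  have hF : ∀ t ∈ Set.Icc (0:ℝ) T,
      HasDerivWithinAt F (a t * (r / δ t - c t)) (Set.Icc 0 T) t := by
    intro t ht
    have hp := (hδb t ht).1
    have hq := hbpos t ht
    rw [hFd]
    have := (((hδ t ht).log hp.ne').const_mul r).add ((hb t ht).log hq.ne')
    have e : a t * (r / δ t - c t) = r * (a t / δ t) + -(a t * b t * c t) / b t := by
      field_simp
      ring
    rw [e]
    exact this
  have key : ∀ σ τ : ℝ, |σ| = 1 → |τ| = 1 → ∀ s t, 0 ≤ s → s ≤ t → t ≤ T →
      (∀ x ∈ Set.Icc s t, 0 ≤ σ * a x) →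
      τ * (F t - F s) ≤ C₀ * δ₀ := by
    intro σ τ hσ hτ s t hs hst ht hx
    have h := qc_mono T (fun x => C₀ * (σ * δ x) - τ * F x)
      (fun x => C₀ * (σ * a x) - τ * (a x * (r / δ x - c x)))
      (fun x hx => (((hδ x hx).const_mul σ).const_mul C₀).sub ((hF x hx).const_mul τ))
      s t hs hst ht (by
        intro x hxx
        have hm : x ∈ Set.Icc 0 T := ⟨hs.trans hxx.1, hxx.2.trans ht⟩
        have h1 := hcb x hm
        have h2 : |a x| = σ * a x := by
          rw [← abs_of_nonneg (hx x hxx), abs_mul, hσ, one_mul]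
        have h3 : τ * (a x * (r / δ x - c x)) ≤ C₀ * |a x| := by
          refine (le_abs_self _).trans ?_
          rw [abs_mul, abs_mul, hτ, one_mul, abs_sub_comm, mul_comm]
          exact mul_le_mul_of_nonneg_right h1 (abs_nonneg _)
        rw [h2] at h3
        linarith)
    have hds := hδb s ⟨hs, hst.trans ht⟩
    have hdt := hδb t ⟨hs.trans hst, ht⟩
    have h5 : σ * (δ t - δ s) ≤ δ₀ := by
      rcases (abs_eq zero_le_one).1 hσ with rfl | rfl <;> linarith [hds.1, hds.2, hdt.1, hdt.2]
    have h6 := mul_le_mul_of_nonneg_left h5 hC₀.le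
    linarith
  have hpos : 0 < C₀ * δ₀ := mul_pos hC₀ hδ₀.1
  have key2 : ∀ τ : ℝ, |τ| = 1 → ∀ s t, 0 ≤ s → s ≤ t → t ≤ T →
      τ * (F t - F s) ≤ 2 * C₀ * δ₀ := by
    intro τ hτ s t hs hst ht
    have hpl : ∀ u v, 0 ≤ u → u ≤ v → v ≤ T → 0 ≤ a u → τ * (F v - F u) ≤ C₀ * δ₀ := by
      intro u v hu huv hv h0
      refine key 1 τ (by simp) hτ u v hu huv hv ?_
      intro x hx
      have := hamono u x hu hx.1 (hx.2.trans hv)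
      linarith
    have hmi : ∀ u v, 0 ≤ u → u ≤ v → v ≤ T → a v ≤ 0 → τ * (F v - F u) ≤ C₀ * δ₀ := by
      intro u v hu huv hv h0
      refine key (-1) τ (by simp) hτ u v hu huv hv ?_
      intro x hx
      have := hamono x v (hu.trans hx.1) hx.2 hv
      linarith
    rcases le_total 0 (a s) with h | h
    · linarith [hpl s t hs hst ht h]
    rcases le_total (a t) 0 with h' | h'
    · linarith [hmi s t hs hst ht h']
    have hcont : ContinuousOn a (Set.Icc s t) := fun x hx =>
      ((ha x ⟨hs.trans hx.1, hx.2.trans ht⟩).continuousWithinAt).mono (Set.Icc_subset_Icc hs ht)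
    obtain ⟨m, hm, hm0⟩ := intermediate_value_Icc hst hcont ⟨h, h'⟩
    have e1 := hmi s m hs hm.1 (hm.2.trans ht) hm0.le
    have e2 := hpl m t (hs.trans hm.1) hm.2 ht hm0.ge
    linarith
  have key3 : ∀ s ∈ Set.Icc (0:ℝ) T, ∀ t ∈ Set.Icc (0:ℝ) T, F s ≤ 2 * C₀ * δ₀ + F t := by
    intro s hs t ht
    rcases le_total s t with h | h
    · linarith [key2 (-1) (by simp) s t hs.1 h ht.2]
    · linarith [key2 1 (by simp) t s ht.1 h hs.2]
  have hexp : ∀ t ∈ Set.Icc (0:ℝ) T, δ t ^ r * b t = Real.exp (F t) := by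
    intro t ht
    rw [hFd, Real.exp_add, Real.exp_log (hbpos t ht), Real.rpow_def_of_pos (hδb t ht).1,
      mul_comm r]
  intro t₁ h₁ t₂ h₂
  rw [mul_assoc (Real.exp _), mul_assoc (Real.exp (2 * C₀ * δ₀)), hexp t₁ h₁, hexp t₂ h₂, ← Real.exp_add, ← Real.exp_add,
    Real.exp_le_exp, Real.exp_le_exp]
  exact ⟨by linarith [key3 t₂ h₂ t₁ h₁], key3 t₁ h₁ t₂ h₂⟩
end

section
/- Escape from the cusp neighborhood (scalar form): Let r > 1, C₀ > 0, T > 0, and δ₀ ∈ (0, (r−1)/C₀]. Let δ, a, b : [0,T] → ℝ be C¹ and c : [0,T] → ℝ be continuous, satisfying for all t ∈ [0,T]: a(t)² + b(t)² = 1, 0 < δ(t) ≤ δ₀, δ'(t) = a(t), a'(t) = b(t)²c(t), and |c(t) − r/δ(t)| ≤ C₀. Then T ≤ 2δ₀. (This is the scalar form of the statement that every unit-speed geodesic entering the region {δ ≤ δ₀} leaves it within time 2δ₀.) -/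
/-- **Escape from the cusp neighborhood (scalar form).**
Let `r > 1`, `C₀ > 0`, `T > 0`, `δ₀ ∈ (0, (r-1)/C₀]`.  Let
`δ, a, b : [0,T] → ℝ` be `C¹` and `c : [0,T] → ℝ` continuous, with
`a² + b² = 1`, `0 < δ ≤ δ₀`, `δ' = a`, `a' = b²c`, and `|c - r/δ| ≤ C₀` on
`[0,T]`.  Then `T ≤ 2δ₀`.  (Scalar form of: every unit-speed geodesic entering
the region `{δ ≤ δ₀}` leaves it within time `2δ₀`.) -/
theorem escape_from_cusp_neighborhood
    (r C₀ T δ₀ : ℝ) (hr : 1 < r) (hC₀ : 0 < C₀) (hT : 0 < T)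
    (hδ₀ : δ₀ ∈ Set.Ioc 0 ((r - 1) / C₀))
    (δ a b c : ℝ → ℝ)
    (hδ : ∀ t ∈ Set.Icc (0:ℝ) T, HasDerivWithinAt δ (a t) (Set.Icc 0 T) t)
    (ha : ∀ t ∈ Set.Icc (0:ℝ) T,
      HasDerivWithinAt a (b t ^ 2 * c t) (Set.Icc 0 T) t)
    (hbC1 : ContDiffOn ℝ 1 b (Set.Icc 0 T))
    (hc : ContinuousOn c (Set.Icc 0 T))
    (hab : ∀ t ∈ Set.Icc (0:ℝ) T, a t ^ 2 + b t ^ 2 = 1)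
    (hδb : ∀ t ∈ Set.Icc (0:ℝ) T, 0 < δ t ∧ δ t ≤ δ₀)
    (hcb : ∀ t ∈ Set.Icc (0:ℝ) T, |c t - r / δ t| ≤ C₀) :
    T ≤ 2 * δ₀ := by
  obtain ⟨hδ0, hδ1⟩ := hδ₀
  have hd : ∀ t ∈ Set.Icc (0:ℝ) T, HasDerivWithinAt (fun t => δ t * a t - t)
      (a t * a t + δ t * (b t ^ 2 * c t) - 1) (Set.Icc 0 T) t := fun t ht =>
    ((hδ t ht).mul (ha t ht)).sub (hasDerivWithinAt_id t _)
  have hmono : MonotoneOn (fun t => δ t * a t - t) (Set.Icc 0 T) := by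
    refine monotoneOn_of_hasDerivWithinAt_nonneg (convex_Icc 0 T)
      (fun t ht => (hd t ht).continuousWithinAt)
      (fun t ht => (hd t (interior_subset ht)).mono interior_subset) ?_
    intro t ht
    have ht' := interior_subset ht
    obtain ⟨h1, h2⟩ := hδb t ht'
    have h3 := (abs_le.mp (hcb t ht')).1
    have h4 : δ₀ * C₀ ≤ r - 1 := (le_div_iff₀ hC₀).mp hδ1
    have h5 : 1 ≤ δ t * c t := by
      have e : δ t * (r / δ t) = r := by field_simp
      have h6 : δ t * (r / δ t - C₀) ≤ δ t * c t :=
        mul_le_mul_of_nonneg_left (by linarith) h1.le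
      have h7 : δ t * C₀ ≤ δ₀ * C₀ := mul_le_mul_of_nonneg_right h2 hC₀.le
      rw [mul_sub, e] at h6
      linarith
    have h8 := hab t ht'
    nlinarith [mul_le_mul_of_nonneg_left h5 (sq_nonneg (b t))]
  have m0 : (0:ℝ) ∈ Set.Icc 0 T := ⟨le_rfl, hT.le⟩
  have mT : T ∈ Set.Icc 0 T := ⟨hT.le, le_rfl⟩
  have key := hmono m0 mT hT.le
  have bound : ∀ t ∈ Set.Icc (0:ℝ) T, |δ t * a t| ≤ δ₀ := by
    intro t ht
    obtain ⟨h1, h2⟩ := hδb t ht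
    have h3 : |a t| ≤ 1 := by
      rw [← sq_le_one_iff_abs_le_one]
      nlinarith [hab t ht, sq_nonneg (b t)]
    rw [abs_mul, abs_of_pos h1]
    nlinarith [abs_nonneg (a t)]
  have k0 := (abs_le.mp (bound 0 m0)).1
  have kT := (abs_le.mp (bound T mT)).2
  simp only at key
  linarith
end
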